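/- Let G be a finite subgroup of GL(n,ℝ) of order m. Let σ_1,…,σ_p be homogeneous polynomials generating the ℝ-algebra of G-invariant polynomials on ℝ^n, and set σ = (σ_1,…,σ_p) : ℝ^n → ℝ^p. Let δ > 0. Then every G-invariant Gevrey function f ∈ G^{1+δ}(ℝ^n) has the form f = F ∘ σ for some Gevrey function F ∈ G^{1+δm}(ℝ^p). -/

import Mathlib

open scoped Nat ENNReal
open Matrix

/-- `f` belongs to the Denjoy–Carleman class `C^M` on the open set `U`. -/
def CMClassOn {E F : Type*} [NormedAddCommGroup E] [NormedSpace ℝ E]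
    [NormedAddCommGroup F] [NormedSpace ℝ F]
    (M : ℕ → ℝ) (U : Set E) (f : E → F) : Prop :=
  ContDiffOn ℝ (⊤ : ℕ∞) f U ∧
    ∀ K : Set E, K ⊆ U → IsCompact K →
      ∃ C > (0 : ℝ), ∃ ρ > (0 : ℝ), ∀ k : ℕ, ∀ x ∈ K,
        ‖iteratedFDerivWithin ℝ k f U x‖ ≤ C * ρ ^ k * (k ! : ℝ) * M k

/-- DC-weight sequence: `M 0 = 1`, positive, increasing, logarithmically convex,
and `sup_k (M (k+1) / M k) ^ (1/k) < ∞`. -/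
def DCWeightSeq (M : ℕ → ℝ) : Prop :=
  M 0 = 1 ∧ (∀ k, 0 < M k) ∧ (∀ k, M k ≤ M (k + 1)) ∧
    (∀ k : ℕ, 1 ≤ k → M k ^ 2 ≤ M (k - 1) * M (k + 1)) ∧
    ∃ C : ℝ, ∀ k : ℕ, 1 ≤ k → (M (k + 1) / M k) ^ ((1 : ℝ) / k) ≤ C

/-- Strong regularity: strong non-quasianalyticity together with moderate growth. -/
def StronglyRegular (N : ℕ → ℝ) : Prop :=
  (∃ C > (0 : ℝ), ∀ j : ℕ,
      ∑' k : ℕ, N (j + k) / (((j + k + 1 : ℕ) : ℝ) * N (j + k + 1)) ≤ C * (N j / N (j + 1))) ∧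
    ∃ C : ℝ, ∀ j k : ℕ, 1 ≤ j → 1 ≤ k →
      (N (j + k) / (N j * N k)) ^ ((1 : ℝ) / ((j : ℝ) + (k : ℝ))) ≤ C

/-- Leibniz rule for factorial-type bounds: products of functions. -/
theorem norm_iteratedFDeriv_mul_le_of_weights {E A : Type*} [NormedAddCommGroup E]
    [NormedSpace ℝ E] [NormedRing A] [NormedAlgebra ℝ A] {f g : E → A}
    {S : Set E} (hS : IsOpen S) (hf : ContDiffOn ℝ (⊤ : ℕ∞) f S)
    (hg : ContDiffOn ℝ (⊤ : ℕ∞) g S) {x : E} (hx : x ∈ S) {C₁ C₂ ρ : ℝ}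
    {M M' M'' : ℕ → ℝ} (hρ : 0 ≤ ρ) (hC₁ : 0 ≤ C₁) (hC₂ : 0 ≤ C₂) (hM0 : ∀ k, 0 ≤ M k)
    (hM : ∀ i j, M i * M' j ≤ M'' (i + j))
    (h₁ : ∀ k, ‖iteratedFDeriv ℝ k f x‖ ≤ C₁ * ρ ^ k * (k ! : ℝ) * M k)
    (h₂ : ∀ k, ‖iteratedFDeriv ℝ k g x‖ ≤ C₂ * ρ ^ k * (k ! : ℝ) * M' k) (k : ℕ) :
    ‖iteratedFDeriv ℝ k (fun y => f y * g y) x‖ ≤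
      C₁ * C₂ * (2 * ρ) ^ k * (k ! : ℝ) * M'' k := by
  have hterm : ∀ i ∈ Finset.range (k + 1), (k.choose i : ℝ) * ‖iteratedFDeriv ℝ i f x‖ *
      ‖iteratedFDeriv ℝ (k - i) g x‖ ≤ C₁ * C₂ * ρ ^ k * (k ! : ℝ) * M'' k := by
    intro i hi
    have hik : i ≤ k := Nat.lt_succ_iff.mp (Finset.mem_range.mp hi)
    have e1 : ρ ^ k = ρ ^ i * ρ ^ (k - i) := by rw [← pow_add, Nat.add_sub_cancel' hik]
    have e2 : (k ! : ℝ) = k.choose i * i ! * (k - i)! := by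
      exact_mod_cast (Nat.choose_mul_factorial_mul_factorial hik).symm
    have e3 := hM i (k - i)
    rw [Nat.add_sub_cancel' hik] at e3
    have hn := hM0 i
    calc _ ≤ (k.choose i : ℝ) * (C₁ * ρ ^ i * (i ! : ℝ) * M i) *
          (C₂ * ρ ^ (k - i) * ((k - i)! : ℝ) * M' (k - i)) := by
          gcongr
          · exact h₁ i
          · exact h₂ (k - i)
      _ = C₁ * C₂ * ρ ^ k * (k ! : ℝ) * (M i * M' (k - i)) := by rw [e1, e2]; ring
      _ ≤ _ := by gcongr
  have h0 : 0 ≤ C₁ * C₂ * ρ ^ k * (k ! : ℝ) * M'' k := by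
    refine le_trans ?_ (hterm 0 (by simp))
    positivity
  have h2 : ((k : ℝ) + 1) ≤ 2 ^ k := by exact_mod_cast Nat.lt_two_pow_self
  have hL := norm_iteratedFDerivWithin_mul_le hf hg hS.uniqueDiffOn hx (n := k)
    (by exact_mod_cast le_top)
  simp only [iteratedFDerivWithin_of_isOpen _ hS hx] at hL
  calc _ ≤ _ := hL
    _ ≤ ∑ i ∈ Finset.range (k + 1), C₁ * C₂ * ρ ^ k * (k ! : ℝ) * M'' k :=
        Finset.sum_le_sum hterm
    _ = (k + 1) * (C₁ * C₂ * ρ ^ k * (k ! : ℝ) * M'' k) := by simp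
    _ ≤ 2 ^ k * (C₁ * C₂ * ρ ^ k * (k ! : ℝ) * M'' k) := by gcongr
    _ = _ := by rw [mul_pow]; ring

theorem choose_mul_factorial_le (j k i : ℕ) (hi : i ≤ k) :
    k.choose i * (j + 1 + i)! * (k - i + 1)! ≤ 2 ^ (k - i) * (j + (k + 1))! := by
  obtain ⟨l, rfl⟩ := Nat.exists_eq_add_of_le hi
  have h1 : i + l - i = l := by omega
  rw [h1]
  have hb : l + 1 ≤ 2 ^ l := Nat.lt_two_pow_self
  have hc : (i + l).choose i ≤ (j + 1 + i + l).choose (j + 1 + i) := by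
    have e1 : (i + l).choose i = (i + l).choose l := by
      rw [← Nat.choose_symm_of_eq_add (Nat.add_comm i l)]
    have e2 : (j + 1 + i + l).choose (j + 1 + i) = (j + 1 + i + l).choose l := by
      rw [← Nat.choose_symm_of_eq_add (Nat.add_comm (j + 1 + i) l)]
    rw [e1, e2]
    exact Nat.choose_le_choose l (by omega)
  have he := Nat.choose_mul_factorial_mul_factorial (Nat.le_add_right (j + 1 + i) l)
  rw [Nat.add_sub_cancel_left] at he
  have hj : j + (i + l + 1) = j + 1 + i + l := by omega
  rw [hj, ← he, Nat.factorial_succ]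
  calc _ ≤ (j + 1 + i + l).choose (j + 1 + i) * (j + 1 + i)! * (2 ^ l * l !) := by gcongr
    _ = _ := by ring

/-- Composition of a function with factorial-type derivative bounds with a function whose
derivatives have analytic-type bounds (general version, for induction). -/
theorem norm_iteratedFDeriv_comp_le_of_weights_aux.{u} {E : Type*} {E' : Type u}
    [NormedAddCommGroup E] [NormedSpace ℝ E] [NormedAddCommGroup E'] [NormedSpace ℝ E']
    {B : E → E'} (hB : ContDiff ℝ (⊤ : ℕ∞) B) {x : E} {b σ : ℝ} (hb : 0 ≤ b) (hσ : 0 < σ)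
    (hBx : ∀ k, ‖iteratedFDeriv ℝ k B x‖ ≤ b * σ ^ k * (k ! : ℝ))
    {C ρ : ℝ} (hC : 0 ≤ C) (hρ : 0 ≤ ρ) {M : ℕ → ℝ} (hM0 : ∀ k, 0 ≤ M k) (hM : Monotone M)
    {lam : ℝ} (hl1 : 4 * σ ≤ lam) (hl2 : 2 * ρ * b * σ ≤ lam) (k : ℕ) :
    ∀ {F : Type u} [NormedAddCommGroup F] [NormedSpace ℝ F] (h : E' → F) (j : ℕ),
      ContDiff ℝ (⊤ : ℕ∞) h →
      (∀ i, ‖iteratedFDeriv ℝ i h (B x)‖ ≤ C * ρ ^ (j + i) * ((j + i)! : ℝ) * M (j + i)) →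
      ‖iteratedFDeriv ℝ k (h ∘ B) x‖ ≤ C * ρ ^ j * lam ^ k * ((j + k)! : ℝ) * M (j + k) := by
  have hl0 : 0 < lam := by linarith
  induction k using Nat.strong_induction_on with
  | _ k ih =>
  intro F _ _ h j hh hbd
  cases k with
  | zero => simpa using hbd 0
  | succ k =>
    have hfd : ContDiff ℝ (⊤ : ℕ∞) (fderiv ℝ h) := hh.fderiv_right (by simp)
    have hBd : ContDiff ℝ (⊤ : ℕ∞) (fderiv ℝ B) := hB.fderiv_right (by simp)
    have e1 : fderiv ℝ (h ∘ B) = fun y =>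
        (ContinuousLinearMap.compL ℝ E E' F) ((fderiv ℝ h ∘ B) y) (fderiv ℝ B y) := by
      ext1 y
      rw [fderiv_comp y (hh.differentiable (by simp) _) (hB.differentiable (by simp) _)]
      rfl
    have hterm : ∀ i ∈ Finset.range (k + 1), (k.choose i : ℝ) *
        ‖iteratedFDeriv ℝ i (fderiv ℝ h ∘ B) x‖ * ‖iteratedFDeriv ℝ (k - i) (fderiv ℝ B) x‖ ≤
        C * ρ ^ j * lam ^ k * (ρ * b * σ) * (((j + (k + 1))! : ℕ) : ℝ) * M (j + (k + 1)) *
          (1 / 2) ^ (k - i) := by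
      intro i hi
      have hik : i ≤ k := Nat.lt_succ_iff.mp (Finset.mem_range.mp hi)
      have a1 := ih i (by omega) (fderiv ℝ h) (j + 1) hfd (fun l => by
        rw [norm_iteratedFDeriv_fderiv]
        have := hbd (l + 1)
        rwa [show j + (l + 1) = j + 1 + l by ring] at this)
      have a2 : ‖iteratedFDeriv ℝ (k - i) (fderiv ℝ B) x‖ ≤
          b * σ ^ (k - i + 1) * ((k - i + 1)! : ℝ) := by
        rw [norm_iteratedFDeriv_fderiv]; exact hBx _
      have a3 : (k.choose i : ℝ) * ((j + 1 + i)! : ℝ) * ((k - i + 1)! : ℝ) ≤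
          2 ^ (k - i) * ((j + (k + 1))! : ℝ) := by
        exact_mod_cast choose_mul_factorial_le j k i hik
      have a4 : M (j + 1 + i) ≤ M (j + (k + 1)) := hM (by omega)
      have a5 : σ ^ (k - i) ≤ (lam / 4) ^ (k - i) := by gcongr; linarith
      have n1 := hM0 (j + 1 + i)
      have n2 := hM0 (j + (k + 1))
      have e2 : lam ^ k = lam ^ i * lam ^ (k - i) := by
        rw [← pow_add, Nat.add_sub_cancel' hik]
      have e3 : (2 : ℝ) ^ (k - i) * (lam / 4) ^ (k - i) = lam ^ (k - i) * (1 / 2) ^ (k - i) := by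
        rw [← mul_pow, ← mul_pow]; congr 1; ring
      calc _ ≤ (k.choose i : ℝ) * (C * ρ ^ (j + 1) * lam ^ i * ((j + 1 + i)! : ℝ) *
            M (j + 1 + i)) * (b * σ ^ (k - i + 1) * ((k - i + 1)! : ℝ)) := by gcongr
        _ = C * ρ ^ (j + 1) * lam ^ i * M (j + 1 + i) * b * σ * σ ^ (k - i) *
            ((k.choose i : ℝ) * ((j + 1 + i)! : ℝ) * ((k - i + 1)! : ℝ)) := by ring
        _ ≤ C * ρ ^ (j + 1) * lam ^ i * M (j + (k + 1)) * b * σ * (lam / 4) ^ (k - i) *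
            (2 ^ (k - i) * ((j + (k + 1))! : ℝ)) := by gcongr
        _ = C * ρ ^ (j + 1) * lam ^ i * M (j + (k + 1)) * b * σ * ((j + (k + 1))! : ℝ) *
            (2 ^ (k - i) * (lam / 4) ^ (k - i)) := by ring
        _ = _ := by rw [e3, e2]; ring
    have hgeo : ∑ i ∈ Finset.range (k + 1), (1 / 2 : ℝ) ^ (k - i) ≤ 2 := by
      have := Finset.sum_range_reflect (fun i => (1 / 2 : ℝ) ^ i) (k + 1)
      simp only [Nat.add_sub_cancel] at this
      have h2 : ∀ i ∈ Finset.range (k + 1), (1 / 2 : ℝ) ^ (k - i) = (1 / 2) ^ (k + 1 - 1 - i) := by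
        intros; simp
      rw [Finset.sum_congr rfl h2]
      simp only [Nat.add_sub_cancel]
      rw [this]
      exact (Summable.sum_le_tsum _ (fun i _ => by positivity) summable_geometric_two).trans
        (le_of_eq tsum_geometric_two)
    have n2 := hM0 (j + (k + 1))
    rw [← norm_iteratedFDeriv_fderiv, e1]
    calc _ ≤ _ := ContinuousLinearMap.norm_iteratedFDeriv_le_of_bilinear_of_le_one _
          (hfd.comp hB) hBd x (n := k) (by exact_mod_cast le_top)
          (ContinuousLinearMap.norm_compL_le ℝ E E' F)
      _ ≤ _ := Finset.sum_le_sum hterm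
      _ = C * ρ ^ j * lam ^ k * (((j + (k + 1))! : ℕ) : ℝ) * M (j + (k + 1)) *
          ((ρ * b * σ) * ∑ i ∈ Finset.range (k + 1), (1 / 2 : ℝ) ^ (k - i)) := by
          rw [← Finset.mul_sum]; ring
      _ ≤ C * ρ ^ j * lam ^ k * (((j + (k + 1))! : ℕ) : ℝ) * M (j + (k + 1)) *
          ((ρ * b * σ) * 2) := by gcongr
      _ ≤ C * ρ ^ j * lam ^ k * (((j + (k + 1))! : ℕ) : ℝ) * M (j + (k + 1)) * lam := by
          gcongr; linarith
      _ = _ := by ring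

/-- Composition of a function with factorial-type derivative bounds with a function whose
derivatives have analytic-type bounds. -/
theorem norm_iteratedFDeriv_comp_le_of_weights.{u} {E : Type*} {E' F : Type u}
    [NormedAddCommGroup E] [NormedSpace ℝ E] [NormedAddCommGroup E'] [NormedSpace ℝ E']
    [NormedAddCommGroup F] [NormedSpace ℝ F]
    {B : E → E'} (hB : ContDiff ℝ (⊤ : ℕ∞) B) {x : E} {b σ : ℝ} (hb : 0 ≤ b) (hσ : 0 < σ)
    (hBx : ∀ k, ‖iteratedFDeriv ℝ k B x‖ ≤ b * σ ^ k * (k ! : ℝ))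
    {C ρ : ℝ} (hC : 0 ≤ C) (hρ : 0 ≤ ρ) {M : ℕ → ℝ} (hM0 : ∀ k, 0 ≤ M k) (hM : Monotone M)
    {h : E' → F} (hh : ContDiff ℝ (⊤ : ℕ∞) h)
    (hbd : ∀ i, ‖iteratedFDeriv ℝ i h (B x)‖ ≤ C * ρ ^ i * (i ! : ℝ) * M i) (k : ℕ) :
    ‖iteratedFDeriv ℝ k (h ∘ B) x‖ ≤
      C * (4 * σ + 2 * ρ * b * σ) ^ k * (k ! : ℝ) * M k := by
  have := norm_iteratedFDeriv_comp_le_of_weights_aux hB hb hσ hBx hC hρ hM0 hM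
    (lam := 4 * σ + 2 * ρ * b * σ) (le_add_of_nonneg_right (by positivity))
    (le_add_of_nonneg_left (by positivity)) k h 0 hh (by simpa using hbd)
  simpa using this

set_option maxSynthPendingDepth 3 in
/-- Smoothness of integrals depending on a parameter, with dominated derivatives of all orders. -/
theorem contDiff_integral_of_dominated {α E F : Type*} [MeasurableSpace α]
    {μ : MeasureTheory.Measure α} [NormedAddCommGroup E] [NormedSpace ℝ E]
    [NormedAddCommGroup F] [NormedSpace ℝ F] [CompleteSpace F] {K : α → E → F}
    (hK : ∀ a, ContDiff ℝ (⊤ : ℕ∞) (K a))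
    (hmeas : ∀ k b, MeasureTheory.AEStronglyMeasurable (fun a => iteratedFDeriv ℝ k (K a) b) μ)
    (hbound : ∀ (r : ℝ) (k : ℕ), ∃ B : α → ℝ, MeasureTheory.Integrable B μ ∧
      ∀ a b, ‖b‖ ≤ r → ‖iteratedFDeriv ℝ k (K a) b‖ ≤ B a) :
    ContDiff ℝ (⊤ : ℕ∞) (fun b => ∫ a, K a b ∂μ) ∧
      ∀ k b, iteratedFDeriv ℝ k (fun b => ∫ a, K a b ∂μ) b =
        ∫ a, iteratedFDeriv ℝ k (K a) b ∂μ := by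
  have hder : ∀ (k : ℕ) (b : E), HasFDerivAt (fun b => ∫ a, iteratedFDeriv ℝ k (K a) b ∂μ)
      ((∫ a, iteratedFDeriv ℝ (k + 1) (K a) b ∂μ).curryLeft) b := by
    intro k b
    obtain ⟨B0, hB0, hB0'⟩ := hbound ‖b‖ k
    obtain ⟨B1, hB1, hB1'⟩ := hbound (‖b‖ + 1) (k + 1)
    let L : (ContinuousMultilinearMap ℝ (fun _ : Fin (k + 1) => E) F) ≃ₗᵢ[ℝ]
        (E →L[ℝ] (ContinuousMultilinearMap ℝ (fun _ : Fin k => E) F)) :=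
      continuousMultilinearCurryLeftEquiv ℝ (fun _ : Fin (k + 1) => E) F
    have e : (∫ a, iteratedFDeriv ℝ (k + 1) (K a) b ∂μ).curryLeft =
        ∫ a, L (iteratedFDeriv ℝ (k + 1) (K a) b) ∂μ := by
      have hi := hB1.mono' (hmeas (k + 1) b)
        (Filter.Eventually.of_forall fun a => hB1' a b (by linarith))
      have hi' : MeasureTheory.Integrable
          (fun a => L (iteratedFDeriv ℝ (k + 1) (K a) b)) μ := by
        refine hB1.mono' (L.continuous.comp_aestronglyMeasurable (hmeas (k + 1) b))
          (Filter.Eventually.of_forall fun a => ?_)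
        rw [L.norm_map]
        exact hB1' a b (by linarith)
      ext v m
      rw [ContinuousLinearMap.integral_apply hi', ContinuousMultilinearMap.integral_apply,
        ContinuousMultilinearMap.curryLeft_apply, ContinuousMultilinearMap.integral_apply hi]
      · rfl
      · exact hi'.apply_continuousLinearMap v
    rw [e]
    refine hasFDerivAt_integral_of_dominated_of_fderiv_le (s := Metric.ball b 1)
      (bound := B1) (F' := fun b a => L (iteratedFDeriv ℝ (k + 1) (K a) b))
      (Metric.ball_mem_nhds b one_pos) (Filter.Eventually.of_forall fun b' => hmeas k b') ?_ ?_ ?_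
      hB1 ?_
    · exact hB0.mono' (hmeas k b) (Filter.Eventually.of_forall fun a => hB0' a b le_rfl)
    · exact L.continuous.comp_aestronglyMeasurable (hmeas (k + 1) b)
    · refine Filter.Eventually.of_forall fun a b' hb' => ?_
      rw [L.norm_map]
      refine hB1' a b' ?_
      have := norm_le_norm_add_norm_sub b b'
      rw [Metric.mem_ball, dist_eq_norm] at hb'
      have h3 : ‖b - b'‖ < 1 := by rwa [norm_sub_rev]
      linarith [norm_le_norm_add_norm_sub b b', norm_le_insert' b' b, norm_sub_rev b' b]
    · refine Filter.Eventually.of_forall fun a b' _ => ?_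
      have h1 := ((hK a).differentiable_iteratedFDeriv (m := k) (by
        exact_mod_cast WithTop.coe_lt_top _)) b'
      have h2 := h1.hasFDerivAt
      rw [fderiv_iteratedFDeriv] at h2
      exact h2
  have hT : HasFTaylorSeriesUpTo (⊤ : ℕ∞) (fun b => ∫ a, K a b ∂μ)
      (fun b k => ∫ a, iteratedFDeriv ℝ k (K a) b ∂μ) := by
    refine ⟨fun b => ?_, fun k _ b => hder k b, fun k _ => ?_⟩
    · obtain ⟨B0, hB0, hB0'⟩ := hbound ‖b‖ 0
      have hi := hB0.mono' (hmeas 0 b) (Filter.Eventually.of_forall fun a => hB0' a b le_rfl)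
      rw [ContinuousMultilinearMap.curry0, ContinuousMultilinearMap.integral_apply hi]
      simp
    · exact continuous_iff_continuousAt.2 fun b => (hder k b).continuousAt
  refine ⟨hT.contDiff, fun k b => ?_⟩
  have := hT.hasFTaylorSeriesUpToOn Set.univ
  have h2 := this.eq_iteratedFDerivWithin_of_uniqueDiffOn (m := k) (by exact_mod_cast le_top)
    uniqueDiffOn_univ (Set.mem_univ b)
  rw [iteratedFDerivWithin_univ] at h2
  exact h2.symm

/-- Derivatives with respect to a finite-dimensional variable of a function depending measurably
on a parameter are again measurable in the parameter. -/
theorem stronglyMeasurable_iteratedFDeriv_param {α ι F : Type*} [MeasurableSpace α] [Fintype ι]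
    [NormedAddCommGroup F] [NormedSpace ℝ F] {K : α → (ι → ℝ) → F}
    (hK : ∀ a, ContDiff ℝ (⊤ : ℕ∞) (K a))
    (hmeas : ∀ b, MeasureTheory.StronglyMeasurable (fun a => K a b)) (k : ℕ) :
    ∀ b, MeasureTheory.StronglyMeasurable (fun a => iteratedFDeriv ℝ k (K a) b) := by
  classical
  induction k with
  | zero =>
    intro b
    exact (continuousMultilinearCurryFin0 ℝ (ι → ℝ) F).symm.continuous.comp_stronglyMeasurable
      (hmeas b)
  | succ k ih =>
    intro b
    have hd : ∀ a, Differentiable ℝ (iteratedFDeriv ℝ k (K a)) := fun a =>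
      (hK a).differentiable_iteratedFDeriv (by exact_mod_cast WithTop.coe_lt_top _)
    have hdir : ∀ v : ι → ℝ, MeasureTheory.StronglyMeasurable
        (fun a => fderiv ℝ (iteratedFDeriv ℝ k (K a)) b v) := by
      intro v
      refine stronglyMeasurable_of_tendsto (ι := ℕ) Filter.atTop
        (f := fun (n : ℕ) (a : α) => ((n : ℝ) + 1) • (iteratedFDeriv ℝ k (K a) (b + ((n : ℝ) + 1)⁻¹ • v) -
          iteratedFDeriv ℝ k (K a) b)) (fun n => ?_) ?_
      · have h := (ih (b + ((n : ℝ) + 1)⁻¹ • v)).sub (ih b)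
        exact h.const_smul ((n : ℝ) + 1)
      · rw [tendsto_pi_nhds]
        intro a
        exact ((hd a b).hasFDerivAt.lim_real v).comp
          (Filter.tendsto_atTop_add_const_right _ _ tendsto_natCast_atTop_atTop)
    have hf : MeasureTheory.StronglyMeasurable
        (fun a => fderiv ℝ (iteratedFDeriv ℝ k (K a)) b) := by
      have e : ∀ T : (ι → ℝ) →L[ℝ] (ContinuousMultilinearMap ℝ (fun _ : Fin k => ι → ℝ) F),
          T = ∑ i, (ContinuousLinearMap.proj i : (ι → ℝ) →L[ℝ] ℝ).smulRight
            (T (Pi.single i 1)) := by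
        intro T
        ext1 v
        conv_lhs => rw [← Finset.univ_sum_single v, map_sum]
        rw [_root_.sum_apply]
        refine Finset.sum_congr rfl fun i _ => ?_
        rw [ContinuousLinearMap.smulRight_apply, ContinuousLinearMap.proj_apply, ← map_smul,
          ← Pi.single_smul]
        simp
      have e2 : (fun a => fderiv ℝ (iteratedFDeriv ℝ k (K a)) b) = fun a => ∑ i,
          (ContinuousLinearMap.smulRightL ℝ (ι → ℝ)
            (ContinuousMultilinearMap ℝ (fun _ : Fin k => ι → ℝ) F)
            (ContinuousLinearMap.proj i : (ι → ℝ) →L[ℝ] ℝ))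
            (fderiv ℝ (iteratedFDeriv ℝ k (K a)) b (Pi.single i 1)) := by
        ext1 a
        exact e _
      rw [e2]
      refine Finset.stronglyMeasurable_fun_sum _ fun i _ => ?_
      exact (ContinuousLinearMap.continuous _).comp_stronglyMeasurable (hdir _)
    exact (continuousMultilinearCurryLeftEquiv ℝ
      (fun _ : Fin (k + 1) => (ι → ℝ)) F).symm.continuous.comp_stronglyMeasurable hf

/-- The weight `(k! / A ^ k) ^ (1 / N)`, submultiplicative in `k`. -/
noncomputable def scaledWeight (N : ℕ) (A : ℝ) (k : ℕ) : ℝ :=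
  ((k ! : ℝ) / A ^ k) ^ ((1 : ℝ) / N)

theorem scaledWeight_nonneg (N : ℕ) {A : ℝ} (hA : 0 < A) (k : ℕ) : 0 ≤ scaledWeight N A k := by
  unfold scaledWeight; positivity

theorem scaledWeight_mul_le (N : ℕ) {A : ℝ} (hA : 0 < A) (i j : ℕ) :
    scaledWeight N A i * scaledWeight N A j ≤ scaledWeight N A (i + j) := by
  unfold scaledWeight
  rw [← Real.mul_rpow (by positivity) (by positivity)]
  apply Real.rpow_le_rpow (by positivity) _ (by positivity)
  rw [div_mul_div_comm, ← pow_add]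
  gcongr
  exact_mod_cast Nat.le_of_dvd (Nat.factorial_pos _) (Nat.factorial_mul_factorial_dvd_factorial_add i j)

theorem one_le_exp_mul_scaledWeight {N : ℕ} (hN : 1 ≤ N) {A : ℝ} (hA : 0 < A) (k : ℕ) :
    1 ≤ Real.exp A * scaledWeight N A k := by
  have h1 : Real.exp (-A) ≤ (k ! : ℝ) / A ^ k := by
    have := Real.pow_div_factorial_le_exp A hA.le k
    rw [Real.exp_neg, ← inv_div]
    exact inv_anti₀ (by positivity) this
  have h2 : Real.exp (-A) ≤ scaledWeight N A k := by
    unfold scaledWeight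
    calc Real.exp (-A) ≤ Real.exp (-A) ^ ((1 : ℝ) / N) := by
          rw [← Real.exp_mul]
          apply Real.exp_le_exp.2
          have : (1 : ℝ) / N ≤ 1 := by
            rw [div_le_one (by positivity)]; exact_mod_cast hN
          nlinarith
      _ ≤ _ := Real.rpow_le_rpow (by positivity) h1 (by positivity)
  calc (1 : ℝ) = Real.exp A * Real.exp (-A) := by rw [← Real.exp_add]; simp
    _ ≤ _ := by gcongr

/-- Cauchy estimates on a disc. -/
theorem norm_iteratedDeriv_le_of_closedBall {f : ℂ → ℂ} {c : ℂ} {R C : ℝ} (hR : 0 < R)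
    (hf : DifferentiableOn ℂ f (Metric.closedBall c R))
    (hC : ∀ z ∈ Metric.closedBall c R, ‖f z‖ ≤ C) (k : ℕ) :
    ‖iteratedDeriv k f c‖ ≤ k ! * C / R ^ k := by
  apply Complex.norm_iteratedDeriv_le_of_forall_mem_sphere_norm_le k hR
  · exact (hf.mono (closure_minimal Metric.ball_subset_closedBall
      Metric.isClosed_closedBall)).diffContOnCl
  · exact fun z hz => hC z (Metric.sphere_subset_closedBall hz)

theorem norm_iteratedFDeriv_real_inv_le {w : ℂ} (hw : 1 / 4 ≤ ‖w‖) (k : ℕ) :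
    ‖iteratedFDeriv ℝ k (fun z : ℂ => z⁻¹) w‖ ≤ 8 * 8 ^ k * k ! := by
  have hw0 : w ≠ 0 := by rintro rfl; norm_num at hw
  have hcd : ContDiffAt ℂ k (fun z : ℂ => z⁻¹) w := contDiffAt_inv ℂ hw0
  have h := (hcd.restrictScalars_iteratedFDeriv_eventuallyEq (𝕜 := ℝ)).eq_of_nhds
  have h2 : ‖iteratedFDeriv ℝ k (fun z : ℂ => z⁻¹) w‖ = ‖iteratedFDeriv ℂ k (fun z : ℂ => z⁻¹) w‖ := by
    rw [← h]; simp
  rw [h2, norm_iteratedFDeriv_eq_norm_iteratedDeriv]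
  have hb : ∀ z ∈ Metric.closedBall w (1 / 8), 1 / 8 ≤ ‖z‖ := by
    intro z hz
    rw [Metric.mem_closedBall, dist_comm, dist_eq_norm] at hz
    have := norm_sub_norm_le w z
    linarith
  refine (norm_iteratedDeriv_le_of_closedBall (R := 1 / 8) (C := 8) (by norm_num) ?_ ?_ k).trans
    (le_of_eq ?_)
  · intro z hz
    have : z ≠ 0 := by
      rintro rfl; have := hb 0 hz; norm_num at this
    exact (differentiableAt_inv this).differentiableWithinAt
  · intro z hz
    rw [norm_inv]
    have := hb z hz
    calc ‖z‖⁻¹ ≤ (1 / 8 : ℝ)⁻¹ := inv_anti₀ (by norm_num) this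
      _ = 8 := by norm_num
  · rw [one_div, inv_pow, div_inv_eq_mul]; ring

theorem iteratedDeriv_expNegInvGlue_pow_eq {N : ℕ} (k : ℕ) {x : ℝ} (hx : 0 < x) :
    iteratedDeriv k (fun y : ℝ => expNegInvGlue (y ^ N)) x =
      (iteratedDeriv k (fun z : ℂ => Complex.exp (-(z ^ N)⁻¹)) x).re := by
  induction k generalizing x with
  | zero =>
    have h : (-((x : ℂ) ^ N)⁻¹) = ((-(x ^ N)⁻¹ : ℝ) : ℂ) := by push_cast; rfl
    simp only [iteratedDeriv_zero]
    rw [h, Complex.exp_ofReal_re, expNegInvGlue, if_neg (by have : 0 < x ^ N := by positivity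
                                                            linarith)]
  | succ k ih =>
    rw [iteratedDeriv_succ, iteratedDeriv_succ]
    have hev : iteratedDeriv k (fun y : ℝ => expNegInvGlue (y ^ N)) =ᶠ[nhds x]
        fun y : ℝ => (iteratedDeriv k (fun z : ℂ => Complex.exp (-(z ^ N)⁻¹)) y).re := by
      filter_upwards [Ioi_mem_nhds hx] with y hy using ih hy
    rw [hev.deriv_eq]
    have hx0 : (x : ℂ) ≠ 0 := by exact_mod_cast hx.ne'
    have han : AnalyticAt ℂ (fun z : ℂ => Complex.exp (-(z ^ N)⁻¹)) x := by
      have : AnalyticAt ℂ (fun z : ℂ => -(z ^ N)⁻¹) x :=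
        ((analyticAt_id.pow N).inv (pow_ne_zero _ hx0)).neg
      exact this.cexp
    have hd : HasDerivAt (iteratedDeriv k (fun z : ℂ => Complex.exp (-(z ^ N)⁻¹)))
        (deriv (iteratedDeriv k (fun z : ℂ => Complex.exp (-(z ^ N)⁻¹))) x) (x : ℂ) := by
      rw [iteratedDeriv_eq_iterate]
      exact (han.iterated_deriv k).differentiableAt.hasDerivAt
    exact hd.real_of_complex.deriv

theorem exists_norm_iteratedFDeriv_expNegInvGlue_pow_le {N : ℕ} (hN : Odd N) :
    ∃ ρ > (0 : ℝ), ∀ k (x : ℝ), ‖iteratedFDeriv ℝ k (fun y : ℝ => expNegInvGlue (y ^ N)) x‖ ≤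
      ρ ^ k * k ! * (k ! : ℝ) ^ ((1 : ℝ) / N) := by
  have hN0 : N ≠ 0 := by rintro rfl; simp at hN
  obtain ⟨κ, hκ, hκb⟩ : ∃ κ > (0 : ℝ), ∀ u : ℂ, ‖u‖ ≤ κ →
      (1 + u) ≠ 0 ∧ 1 / 2 ≤ (((1 + u) ^ N)⁻¹).re := by
    have hc : ContinuousAt (fun u : ℂ => (((1 + u) ^ N)⁻¹).re) 0 := by
      apply Complex.continuous_re.continuousAt.comp
      apply ContinuousAt.inv₀ (by fun_prop) (by simp)
    have h1 : ∀ᶠ u : ℂ in nhds 0, 1 / 2 < (((1 + u) ^ N)⁻¹).re :=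
      hc.eventually (lt_mem_nhds (by norm_num))
    have h2 : ∀ᶠ u : ℂ in nhds 0, (1 + u) ≠ 0 := by
      have : ContinuousAt (fun u : ℂ => 1 + u) 0 := by fun_prop
      exact this.eventually_ne (by simp)
    obtain ⟨r, hr, hrb⟩ := Metric.eventually_nhds_iff.1 (h2.and h1)
    refine ⟨r / 2, by positivity, fun u hu => ?_⟩
    have := hrb (y := u) (by rw [dist_zero_right]; linarith)
    exact ⟨this.1, this.2.le⟩
  have hcd : ContDiff ℝ (⊤ : ℕ∞) (fun y : ℝ => expNegInvGlue (y ^ N)) :=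
    expNegInvGlue.contDiff.comp (contDiff_id.pow N)
  have hpos : ∀ k (x : ℝ), 0 < x → ‖iteratedFDeriv ℝ k (fun y : ℝ => expNegInvGlue (y ^ N)) x‖ ≤
      (2 / κ) ^ k * k ! * (k ! : ℝ) ^ ((1 : ℝ) / N) := by
    intro k x hx
    rw [norm_iteratedFDeriv_eq_norm_iteratedDeriv, iteratedDeriv_expNegInvGlue_pow_eq k hx]
    have hform : ∀ z ∈ Metric.closedBall (x : ℂ) (κ * x), z ≠ 0 ∧
        (x ^ N)⁻¹ / 2 ≤ ((z ^ N)⁻¹).re := by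
      intro z hz
      have hx0 : (x : ℂ) ≠ 0 := by exact_mod_cast hx.ne'
      set u : ℂ := (z - x) / x with hu
      have hzu : z = x * (1 + u) := by rw [hu]; field_simp; ring
      have hun : ‖u‖ ≤ κ := by
        rw [hu, norm_div, Complex.norm_real, Real.norm_of_nonneg hx.le, div_le_iff₀ hx]
        simpa [dist_eq_norm] using hz
      obtain ⟨h1, h2⟩ := hκb u hun
      refine ⟨by rw [hzu]; exact mul_ne_zero hx0 h1, ?_⟩
      have : (z ^ N)⁻¹ = (((x ^ N)⁻¹ : ℝ) : ℂ) * ((1 + u) ^ N)⁻¹ := by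
        rw [hzu, mul_pow, mul_inv]; push_cast; rfl
      rw [this, Complex.re_ofReal_mul]
      have h3 : 0 < (x ^ N)⁻¹ := by positivity
      nlinarith
    have hC := norm_iteratedDeriv_le_of_closedBall
      (f := fun z : ℂ => Complex.exp (-(z ^ N)⁻¹)) (c := x) (R := κ * x)
      (C := Real.exp (-((x ^ N)⁻¹ / 2))) (by positivity)
      (by
        intro z hz
        have h0 := (hform z hz).1
        have : DifferentiableAt ℂ (fun z : ℂ => Complex.exp (-(z ^ N)⁻¹)) z := by
          exact ((differentiableAt_id.pow N).inv (pow_ne_zero _ h0)).neg.cexp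
        exact this.differentiableWithinAt)
      (by
        intro z hz
        rw [Complex.norm_exp, Complex.neg_re]
        apply Real.exp_le_exp.2
        have := (hform z hz).2
        linarith) k
    refine (Complex.abs_re_le_norm _).trans (hC.trans ?_)
    set y := x⁻¹ with hy
    have hy0 : 0 < y := by positivity
    have key : y ^ k * Real.exp (-((x ^ N)⁻¹ / 2)) ≤ 2 ^ k * (k ! : ℝ) ^ ((1 : ℝ) / N) := by
      rw [← inv_pow, ← hy]
      have h1 : (y ^ k * Real.exp (-(y ^ N / 2))) ^ N ≤ (2 ^ k * (k ! : ℝ) ^ ((1 : ℝ) / N)) ^ N := by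
        rw [mul_pow, mul_pow, ← Real.rpow_natCast ((k ! : ℝ) ^ _) N, ← Real.rpow_mul (by positivity),
          one_div_mul_cancel (by exact_mod_cast hN0), Real.rpow_one]
        set t := y ^ N with ht
        have ht0 : 0 < t := by positivity
        have h2 : (t / 2) ^ k / k ! ≤ Real.exp (t / 2) :=
          Real.pow_div_factorial_le_exp _ (by positivity) k
        rw [div_le_iff₀ (by positivity), div_pow, div_le_iff₀ (by positivity)] at h2
        have h3 : (Real.exp (-(t / 2))) ^ N ≤ Real.exp (-(t / 2)) :=
          pow_le_of_le_one (by positivity) (Real.exp_le_one_iff.2 (by linarith)) hN0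
        have h4 : Real.exp (t / 2) * Real.exp (-(t / 2)) = 1 := by rw [← Real.exp_add]; simp
        have h5 : (2 : ℝ) ^ k ≤ (2 ^ k) ^ N := le_self_pow₀ (one_le_pow₀ (by norm_num)) hN0
        calc (y ^ k) ^ N * (Real.exp (-(t / 2))) ^ N = t ^ k * (Real.exp (-(t / 2))) ^ N := by
              rw [ht]; ring
          _ ≤ (Real.exp (t / 2) * k ! * 2 ^ k) * Real.exp (-(t / 2)) := by gcongr
          _ = (Real.exp (t / 2) * Real.exp (-(t / 2))) * (2 ^ k * k !) := by ring
          _ = 2 ^ k * k ! := by rw [h4, one_mul]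
          _ ≤ _ := by gcongr
      exact le_of_pow_le_pow_left₀ hN0 (by positivity) h1
    calc k ! * Real.exp (-((x ^ N)⁻¹ / 2)) / (κ * x) ^ k
        = (κ⁻¹) ^ k * k ! * (y ^ k * Real.exp (-((x ^ N)⁻¹ / 2))) := by
          rw [hy, mul_pow, inv_pow, inv_pow]; field_simp
      _ ≤ (κ⁻¹) ^ k * k ! * (2 ^ k * (k ! : ℝ) ^ ((1 : ℝ) / N)) := by gcongr
      _ = _ := by rw [div_pow, inv_pow]; field_simp
  refine ⟨2 / κ, by positivity, fun k x => ?_⟩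
  have hclosed : IsClosed {x : ℝ | ‖iteratedFDeriv ℝ k (fun y : ℝ => expNegInvGlue (y ^ N)) x‖ ≤
      (2 / κ) ^ k * k ! * (k ! : ℝ) ^ ((1 : ℝ) / N)} :=
    isClosed_le (hcd.continuous_iteratedFDeriv (by exact_mod_cast le_top)).norm continuous_const
  have hsub : ({0}ᶜ : Set ℝ) ⊆ {x : ℝ | ‖iteratedFDeriv ℝ k (fun y : ℝ => expNegInvGlue (y ^ N)) x‖ ≤
      (2 / κ) ^ k * k ! * (k ! : ℝ) ^ ((1 : ℝ) / N)} := by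
    intro y hy
    rcases lt_or_gt_of_ne (show y ≠ 0 from hy) with h | h
    · have hev : (fun y : ℝ => expNegInvGlue (y ^ N)) =ᶠ[nhds y] fun _ => 0 := by
        filter_upwards [Iio_mem_nhds h] with z hz
        exact expNegInvGlue.zero_of_nonpos (hN.pow_nonpos (le_of_lt hz))
      have := (hev.iteratedFDeriv ℝ k).eq_of_nhds
      have h0 : iteratedFDeriv ℝ k (fun _ : ℝ => (0 : ℝ)) y = 0 := by simp
      change ‖_‖ ≤ _
      rw [this, h0, norm_zero]
      positivity
    · exact hpos k y h
  have := hclosed.closure_subset_iff.2 hsub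
  rw [(dense_compl_singleton (0 : ℝ)).closure_eq] at this
  exact this (Set.mem_univ x)

theorem norm_iteratedFDeriv_comp_affine_le {E E' F : Type*} [NormedAddCommGroup E]
    [NormedSpace ℝ E] [NormedAddCommGroup E'] [NormedSpace ℝ E'] [NormedAddCommGroup F]
    [NormedSpace ℝ F] {f : E' → F} (hf : ContDiff ℝ (⊤ : ℕ∞) f) (L : E →L[ℝ] E') (c : E')
    (k : ℕ) (x : E) :
    ‖iteratedFDeriv ℝ k (fun y => f (L y + c)) x‖ ≤ ‖iteratedFDeriv ℝ k f (L x + c)‖ * ‖L‖ ^ k := by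
  have h1 : ContDiff ℝ (⊤ : ℕ∞) (fun y => f (y + c)) := hf.comp (contDiff_id.add contDiff_const)
  have h2 := L.iteratedFDeriv_comp_right h1 x (i := k) (by exact_mod_cast le_top)
  have h3 : (fun y => f (L y + c)) = (fun y => f (y + c)) ∘ L := rfl
  rw [h3, h2, iteratedFDeriv_comp_add_right]
  refine (ContinuousMultilinearMap.norm_compContinuousLinearMap_le _ _).trans ?_
  simp

theorem exists_gevrey_step {N : ℕ} (hN : Odd N) :
    ∃ C > (0 : ℝ), ∃ C₀ > (0 : ℝ), ∃ ρ ≥ (1 : ℝ), ∀ A > (0 : ℝ), ∃ θ : ℝ → ℝ,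
      ContDiff ℝ (⊤ : ℕ∞) θ ∧ (∀ v ≤ 0, θ v = 0) ∧ (∀ v ≥ 1, θ v = 1) ∧
      ∀ k v, ‖iteratedFDeriv ℝ k θ v‖ ≤
        C * Real.exp (C₀ * A) * ρ ^ k * k ! * scaledWeight N A k := by
  have hN0 : N ≠ 0 := by rintro rfl; simp at hN
  have hN1 : 1 ≤ N := Nat.one_le_iff_ne_zero.2 hN0
  obtain ⟨ρ, hρ, hb⟩ := exists_norm_iteratedFDeriv_expNegInvGlue_pow_le hN
  refine ⟨2, by norm_num, 2 * 4 ^ N + 1, by positivity, max (2 * ρ) 1, le_max_right _ _,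
    fun A hA => ?_⟩
  set a : ℝ := (A⁻¹) ^ ((1 : ℝ) / N) with ha
  have ha0 : 0 < a := by positivity
  have haN : a ^ N = A⁻¹ := by
    rw [ha, ← Real.rpow_natCast, ← Real.rpow_mul (by positivity),
          one_div_mul_cancel (by exact_mod_cast hN0), Real.rpow_one]
  set ψ : ℝ → ℝ := fun y => expNegInvGlue (y ^ N) with hψ
  have hψc : ContDiff ℝ (⊤ : ℕ∞) ψ := expNegInvGlue.contDiff.comp (contDiff_id.pow N)
  have hWa : ∀ k, a ^ k * (k ! : ℝ) ^ ((1 : ℝ) / N) = scaledWeight N A k := by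
    intro k
    rw [scaledWeight, ha, ← Real.rpow_natCast, ← Real.rpow_mul (by positivity), mul_comm _ (k : ℝ),
      Real.rpow_mul (by positivity), Real.rpow_natCast, ← Real.mul_rpow (by positivity) (by positivity),
      inv_pow, mul_comm (A ^ k)⁻¹, ← div_eq_mul_inv]
  have hscale : ∀ (e c : ℝ), |e| = 1 → ContDiff ℝ (⊤ : ℕ∞) (fun y : ℝ => ψ (a * (e * y + c))) ∧
      ∀ k y, ‖iteratedFDeriv ℝ k (fun y : ℝ => ψ (a * (e * y + c))) y‖ ≤
        1 * ρ ^ k * k ! * scaledWeight N A k := by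
    intro e c he
    refine ⟨hψc.comp (by fun_prop), fun k y => ?_⟩
    have h := norm_iteratedFDeriv_comp_affine_le hψc ((a * e) • ContinuousLinearMap.id ℝ ℝ) (a * c) k y
    have hfun : (fun y : ℝ => ψ (a * (e * y + c))) =
        fun y => ψ (((a * e) • ContinuousLinearMap.id ℝ ℝ) y + a * c) := by
      ext y; simp; ring_nf
    rw [hfun]
    refine h.trans ?_
    have hn : ‖(a * e) • ContinuousLinearMap.id ℝ ℝ‖ = a := by
      rw [norm_smul, ContinuousLinearMap.norm_id, mul_one, Real.norm_eq_abs, abs_mul, he,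
        abs_of_pos ha0, mul_one]
    rw [hn]
    calc _ ≤ (ρ ^ k * k ! * (k ! : ℝ) ^ ((1 : ℝ) / N)) * a ^ k := by gcongr; exact hb k _
      _ = 1 * ρ ^ k * k ! * (a ^ k * (k ! : ℝ) ^ ((1 : ℝ) / N)) := by ring
      _ = _ := by rw [hWa]
  obtain ⟨hc1, hb1⟩ := hscale 1 0 (by simp)
  obtain ⟨hc2, hb2⟩ := hscale (-1) 1 (by simp)
  set h : ℝ → ℝ := fun y => ψ (a * (1 * y + 0)) * ψ (a * (-1 * y + 1)) with hh
  have hhc : ContDiff ℝ (⊤ : ℕ∞) h := hc1.mul hc2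
  have hhb : ∀ k y, ‖iteratedFDeriv ℝ k h y‖ ≤ (2 * ρ) ^ k * k ! * scaledWeight N A k := by
    intro k y
    have := norm_iteratedFDeriv_mul_le_of_weights isOpen_univ hc1.contDiffOn hc2.contDiffOn
      (Set.mem_univ y) hρ.le zero_le_one zero_le_one (scaledWeight_nonneg N hA)
      (scaledWeight_mul_le N hA) (fun k => hb1 k y) (fun k => hb2 k y) k
    rwa [one_mul, one_mul] at this
  have hψ0 : ∀ y ≤ 0, ψ y = 0 := fun y hy => expNegInvGlue.zero_of_nonpos (hN.pow_nonpos hy)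
  have hψnn : ∀ y, 0 ≤ ψ y := fun y => expNegInvGlue.nonneg _
  have hψ1 : ∀ y, ψ y ≤ 1 := by
    intro y
    simp only [hψ, expNegInvGlue]
    split_ifs with h
    · exact zero_le_one
    · exact Real.exp_le_one_iff.2 (by simp; linarith)
  have hnn : ∀ y, 0 ≤ h y := fun y => mul_nonneg (hψnn _) (hψnn _)
  have h0l : ∀ y ≤ 0, h y = 0 := fun y hy => by
    rw [hh]; simp only; rw [hψ0 _ (by nlinarith), zero_mul]
  have h0r : ∀ y ≥ 1, h y = 0 := fun y hy => by
    rw [hh]; simp only; rw [hψ0 (a * (-1 * y + 1)) (by nlinarith), mul_zero]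
  have hle1 : ∀ y, h y ≤ 1 := fun y => mul_le_one₀ (hψ1 _) (hψnn _) (hψ1 _)
  have hψlow : ∀ y ≥ (1 / 4 : ℝ), Real.exp (-(4 ^ N * A)) ≤ ψ (a * y) := by
    intro y hy
    have hpos : 0 < (a * y) ^ N := by positivity
    simp only [hψ, expNegInvGlue]
    rw [if_neg (by linarith)]
    apply Real.exp_le_exp.2
    rw [mul_pow, haN, mul_inv, inv_inv, ← inv_pow]
    have : y⁻¹ ^ N ≤ 4 ^ N := by
      gcongr
      calc y⁻¹ ≤ (1 / 4 : ℝ)⁻¹ := inv_anti₀ (by norm_num) hy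
        _ = 4 := by norm_num
    nlinarith
  have h_int : ∀ u v, IntervalIntegrable h MeasureTheory.volume u v := fun u v =>
    hhc.continuous.intervalIntegrable u v
  set I : ℝ := ∫ y in (0 : ℝ)..1, h y with hI
  have hIlow : Real.exp (-(2 * 4 ^ N * A)) / 2 ≤ I := by
    have e1 : I = (∫ y in (0 : ℝ)..(1 / 4), h y) + (∫ y in (1 / 4 : ℝ)..(3 / 4), h y)
        + ∫ y in (3 / 4 : ℝ)..1, h y := by
      rw [intervalIntegral.integral_add_adjacent_intervals (h_int _ _) (h_int _ _),
        intervalIntegral.integral_add_adjacent_intervals (h_int _ _) (h_int _ _)]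
    have e2 : 0 ≤ ∫ y in (0 : ℝ)..(1 / 4), h y :=
      intervalIntegral.integral_nonneg (by norm_num) fun y _ => hnn y
    have e3 : 0 ≤ ∫ y in (3 / 4 : ℝ)..1, h y :=
      intervalIntegral.integral_nonneg (by norm_num) fun y _ => hnn y
    have e4 : (∫ _ in (1 / 4 : ℝ)..(3 / 4), Real.exp (-(2 * 4 ^ N * A))) ≤
        ∫ y in (1 / 4 : ℝ)..(3 / 4), h y := by
      apply intervalIntegral.integral_mono_on (by norm_num) (by simp) (h_int _ _)
      intro y hy
      have : Real.exp (-(2 * 4 ^ N * A)) = Real.exp (-(4 ^ N * A)) * Real.exp (-(4 ^ N * A)) := by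
        rw [← Real.exp_add]; ring_nf
      rw [this]
      apply mul_le_mul (hψlow _ _) (hψlow _ _) (by positivity) (hψnn _)
      · linarith [hy.1]
      · linarith [hy.2]
    rw [intervalIntegral.integral_const, smul_eq_mul] at e4
    linarith
  have hI0 : 0 < I := lt_of_lt_of_le (by positivity) hIlow
  have hIinv : I⁻¹ ≤ 2 * Real.exp (2 * 4 ^ N * A) := by
    calc I⁻¹ ≤ (Real.exp (-(2 * 4 ^ N * A)) / 2)⁻¹ := inv_anti₀ (by positivity) hIlow
      _ = _ := by rw [Real.exp_neg]; field_simp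
  set θ : ℝ → ℝ := fun v => I⁻¹ * ∫ y in (0 : ℝ)..v, h y with hθ
  have hder : ∀ v, HasDerivAt θ (I⁻¹ * h v) v := fun v =>
    (intervalIntegral.integral_hasDerivAt_right (h_int _ _)
      (hhc.continuous.stronglyMeasurableAtFilter _ _) hhc.continuous.continuousAt).const_mul _
  have hderiv : deriv θ = fun v => I⁻¹ * h v := funext fun v => (hder v).deriv
  have hθc : ContDiff ℝ (⊤ : ℕ∞) θ := by
    apply contDiff_infty_iff_deriv.2
    refine ⟨fun v => (hder v).differentiableAt, ?_⟩
    rw [hderiv]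
    exact contDiff_const.mul hhc
  have hθ0 : ∀ v ≤ 0, θ v = 0 := by
    intro v hv
    simp only [hθ]
    rw [intervalIntegral.integral_congr (g := fun _ => 0)]
    · simp
    · intro y hy
      rw [Set.uIcc_of_ge hv] at hy
      exact h0l y hy.2
  have hθ1 : ∀ v ≥ 1, θ v = 1 := by
    intro v hv
    simp only [hθ]
    rw [← intervalIntegral.integral_add_adjacent_intervals (h_int 0 1) (h_int 1 v),
      intervalIntegral.integral_congr (g := fun _ => 0) (a := 1)]
    · simp [← hI, hI0.ne']
    · intro y hy
      rw [Set.uIcc_of_le hv] at hy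
      exact h0r y hy.1
  have hθb : ∀ v, ‖θ v‖ ≤ 1 := by
    have hmono : Monotone θ := by
      apply monotone_of_deriv_nonneg (fun v => (hder v).differentiableAt)
      intro v
      rw [hderiv]
      exact mul_nonneg (by positivity) (hnn v)
    intro v
    have h1 : 0 ≤ θ v := by
      rcases le_total v 0 with hv | hv
      · rw [hθ0 v hv]
      · rw [← hθ0 0 le_rfl]; exact hmono hv
    have h2 : θ v ≤ 1 := by
      rcases le_total v 1 with hv | hv
      · rw [← hθ1 1 le_rfl]; exact hmono hv
      · rw [hθ1 v hv]
    rw [Real.norm_of_nonneg h1]; exact h2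
  refine ⟨θ, hθc, hθ0, hθ1, fun k v => ?_⟩
  rcases k with _ | k
  · rw [norm_iteratedFDeriv_zero]
    have : (1 : ℝ) ≤ Real.exp ((2 * 4 ^ N + 1) * A) := Real.one_le_exp (by positivity)
    have h2 : scaledWeight N A 0 = 1 := by simp [scaledWeight]
    rw [h2]
    have := hθb v
    simp only [pow_zero, Nat.factorial_zero, Nat.cast_one]
    linarith
  · rw [norm_iteratedFDeriv_eq_norm_iteratedDeriv, iteratedDeriv_succ', hderiv]
    have e1 : iteratedDeriv k (fun v => I⁻¹ * h v) v = I⁻¹ * iteratedDeriv k h v :=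
      iteratedDeriv_const_mul_field I⁻¹ h
    rw [e1, norm_mul, ← norm_iteratedFDeriv_eq_norm_iteratedDeriv, Real.norm_of_nonneg (by positivity)]
    have e2 : scaledWeight N A k ≤ Real.exp A * scaledWeight N A (k + 1) := by
      have := one_le_exp_mul_scaledWeight hN1 hA 1
      have h3 := scaledWeight_mul_le N hA k 1
      have h4 := scaledWeight_nonneg N hA k
      calc scaledWeight N A k ≤ scaledWeight N A k * (Real.exp A * scaledWeight N A 1) :=
            le_mul_of_one_le_right h4 this
        _ = Real.exp A * (scaledWeight N A k * scaledWeight N A 1) := by ring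
        _ ≤ _ := by gcongr
    have h5 := scaledWeight_nonneg N hA (k + 1)
    have e3 : (2 * ρ) ^ k ≤ max (2 * ρ) 1 ^ (k + 1) :=
      (pow_le_pow_left₀ (by positivity) (le_max_left _ _) k).trans
        (pow_le_pow_right₀ (le_max_right _ _) (Nat.le_succ k))
    have e4 : (k ! : ℝ) ≤ ((k + 1)! : ℝ) := by exact_mod_cast Nat.factorial_le (Nat.le_succ k)
    calc I⁻¹ * ‖iteratedFDeriv ℝ k h v‖
        ≤ (2 * Real.exp (2 * 4 ^ N * A)) * ((2 * ρ) ^ k * k ! * scaledWeight N A k) := by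
          gcongr; exact hhb k v
      _ ≤ (2 * Real.exp (2 * 4 ^ N * A)) * (max (2 * ρ) 1 ^ (k + 1) * (k + 1)! *
            (Real.exp A * scaledWeight N A (k + 1))) := by
          gcongr
          exact scaledWeight_nonneg N hA k
      _ = 2 * (Real.exp (2 * 4 ^ N * A) * Real.exp A) * max (2 * ρ) 1 ^ (k + 1) * (k + 1)! *
            scaledWeight N A (k + 1) := by ring
      _ = _ := by rw [← Real.exp_add]; ring_nf

theorem exists_regularized_inv {N : ℕ} (hN : Odd N) :
    ∃ C > (0 : ℝ), ∃ C₀ > (0 : ℝ), ∃ ρ > (0 : ℝ), ∀ A > (0 : ℝ), ∃ Ψ : ℂ → ℂ,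
      ContDiff ℝ (⊤ : ℕ∞) Ψ ∧ (∀ w, 1 ≤ ‖w‖ → Ψ w = w⁻¹) ∧
      ∀ k w, ‖iteratedFDeriv ℝ k Ψ w‖ ≤
        C * Real.exp (C₀ * A) * ρ ^ k * k ! * scaledWeight N A k := by
  have hN0 : N ≠ 0 := by rintro rfl; simp at hN
  have hN1 : 1 ≤ N := Nat.one_le_iff_ne_zero.2 hN0
  obtain ⟨C, hC, C₀, hC₀, ρ, hρ1, H⟩ := exists_gevrey_step hN
  have hρ : 0 < ρ := by linarith
  refine ⟨(1 + C ^ 4) * 8, by positivity, 4 * C₀ + 2, by positivity, 2 * (2 * (2 * (4 * ρ))),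
    by positivity, fun A hA => ?_⟩
  obtain ⟨θ, hθc, hθ0, hθ1, hθb⟩ := H A hA
  have hW := scaledWeight_nonneg N hA
  have hWm := scaledWeight_mul_le N hA
  have hone := one_le_exp_mul_scaledWeight hN1 hA
  set K : ℝ := C * Real.exp (C₀ * A) with hK
  have hK0 : 0 < K := by positivity
  have hr : ∀ L : ℂ →L[ℝ] ℝ, ‖L‖ ≤ 1 →
      ContDiff ℝ (⊤ : ℕ∞) (fun w => θ (2 + 4 * L w)) ∧
      ∀ w k, ‖iteratedFDeriv ℝ k (fun w => θ (2 + 4 * L w)) w‖ ≤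
        K * (4 * ρ) ^ k * k ! * scaledWeight N A k := by
    intro L hL
    refine ⟨hθc.comp (by fun_prop), fun w k => ?_⟩
    have h := norm_iteratedFDeriv_comp_affine_le hθc ((4 : ℝ) • L) 2 k w
    have hfun : (fun w => θ (2 + 4 * L w)) = fun w => θ (((4 : ℝ) • L) w + 2) := by
      ext y; simp; ring_nf
    rw [hfun]
    have hn : ‖(4 : ℝ) • L‖ ≤ 4 := by
      rw [norm_smul, Real.norm_of_nonneg (by norm_num)]; linarith
    refine h.trans ?_
    calc _ ≤ (K * ρ ^ k * k ! * scaledWeight N A k) * 4 ^ k := by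
          gcongr
          · have := hW k; positivity
          · exact hθb k _
      _ = _ := by rw [mul_pow]; ring
  have hre : ‖Complex.reCLM‖ ≤ 1 := by simp
  have him : ‖Complex.imCLM‖ ≤ 1 := by simp
  obtain ⟨c1, b1⟩ := hr Complex.reCLM hre
  obtain ⟨c2, b2⟩ := hr (-Complex.reCLM) (by rwa [norm_neg])
  obtain ⟨c3, b3⟩ := hr Complex.imCLM him
  obtain ⟨c4, b4⟩ := hr (-Complex.imCLM) (by rwa [norm_neg])
  have hm : ∀ {f g : ℂ → ℝ} {C₁ C₂ R : ℝ}, ContDiff ℝ (⊤ : ℕ∞) f → ContDiff ℝ (⊤ : ℕ∞) g →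
      0 ≤ R → 0 ≤ C₁ → 0 ≤ C₂ →
      (∀ w k, ‖iteratedFDeriv ℝ k f w‖ ≤ C₁ * R ^ k * k ! * scaledWeight N A k) →
      (∀ w k, ‖iteratedFDeriv ℝ k g w‖ ≤ C₂ * R ^ k * k ! * scaledWeight N A k) →
      ∀ w k, ‖iteratedFDeriv ℝ k (fun y => f y * g y) w‖ ≤
        C₁ * C₂ * (2 * R) ^ k * k ! * scaledWeight N A k :=
    fun hf hg hR h1 h2 hfb hgb w k => norm_iteratedFDeriv_mul_le_of_weights isOpen_univ
      hf.contDiffOn hg.contDiffOn (Set.mem_univ w) hR h1 h2 hW hWm (hfb w) (hgb w) k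
  have b12 := hm c1 c2 (by positivity) hK0.le hK0.le b1 b2
  have b34 := hm c3 c4 (by positivity) hK0.le hK0.le b3 b4
  have c12 := c1.mul c2
  have c34 := c3.mul c4
  have bq := hm c12 c34 (by positivity) (by positivity) (by positivity) b12 b34
  have cq := c12.mul c34
  set q : ℂ → ℝ := fun w => θ (2 + 4 * Complex.reCLM w) * θ (2 + 4 * (-Complex.reCLM) w) *
    (θ (2 + 4 * Complex.imCLM w) * θ (2 + 4 * (-Complex.imCLM) w)) with hq
  set R : ℝ := 2 * (2 * (4 * ρ)) with hR
  have hR16 : 16 ≤ R := by rw [hR]; linarith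
  have hqone : ∀ w : ℂ, ‖w‖ ≤ 1 / 4 → q w = 1 := by
    intro w hw
    have h1 := (Complex.abs_re_le_norm w).trans hw
    have h2 := (Complex.abs_im_le_norm w).trans hw
    rw [abs_le] at h1 h2
    simp only [hq, Complex.reCLM_apply, Complex.imCLM_apply, _root_.neg_apply]
    rw [hθ1 _ (by linarith), hθ1 _ (by linarith), hθ1 _ (by linarith), hθ1 _ (by linarith)]
    norm_num
  have hqzero : ∀ w : ℂ, 1 ≤ ‖w‖ → q w = 0 := by
    intro w hw
    have h1 : 1 ≤ |w.re| + |w.im| := hw.trans (Complex.norm_le_abs_re_add_abs_im w)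
    have h2 : 1 / 2 ≤ |w.re| ∨ 1 / 2 ≤ |w.im| := by
      by_contra! h; linarith
    simp only [hq, Complex.reCLM_apply, Complex.imCLM_apply, _root_.neg_apply]
    rcases h2 with h | h <;> rcases le_abs'.1 h with h | h
    · rw [hθ0 (2 + 4 * w.re) (by linarith)]; ring
    · rw [hθ0 (2 + 4 * -w.re) (by linarith)]; ring
    · rw [hθ0 (2 + 4 * w.im) (by linarith)]; ring
    · rw [hθ0 (2 + 4 * -w.im) (by linarith)]; ring
  set g : ℂ → ℂ := fun w => Complex.ofRealLI (1 - q w) with hg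
  have c1q : ContDiff ℝ (⊤ : ℕ∞) (fun w => 1 - q w) := contDiff_const.sub cq
  have cg : ContDiff ℝ (⊤ : ℕ∞) g := Complex.ofRealLI.contDiff.comp c1q
  have bg : ∀ w k, ‖iteratedFDeriv ℝ k g w‖ ≤
      (Real.exp A + K ^ 4) * R ^ k * k ! * scaledWeight N A k := by
    intro w k
    have e0 : g = Complex.ofRealLI ∘ fun w => 1 - q w := rfl
    have e1 : ‖iteratedFDeriv ℝ k g w‖ = ‖iteratedFDeriv ℝ k (fun w => 1 - q w) w‖ := by
      rw [e0]
      exact Complex.ofRealLI.norm_iteratedFDeriv_comp_left c1q.contDiffAt (by exact_mod_cast le_top)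
    rw [e1]
    have e2 : iteratedFDeriv ℝ k (fun w => 1 - q w) w =
        iteratedFDeriv ℝ k (fun _ : ℂ => (1 : ℝ)) w - iteratedFDeriv ℝ k q w :=
      fun_iteratedFDeriv_sub_apply contDiffAt_const
        (cq.contDiffAt.of_le (by exact_mod_cast le_top))
    have e3 : ‖iteratedFDeriv ℝ k (fun _ : ℂ => (1 : ℝ)) w‖ ≤ 1 := by
      rcases k with _ | k
      · simp
      · rw [iteratedFDeriv_const_of_ne (by simp)]; simp
    have e4 : (1 : ℝ) ≤ R ^ k * k ! := by
      have h1 : (1 : ℝ) ≤ R ^ k := one_le_pow₀ (by linarith)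
      have h2 : (1 : ℝ) ≤ k ! := by exact_mod_cast Nat.factorial_pos k
      nlinarith
    rw [e2]
    refine (norm_sub_le _ _).trans ?_
    have e5 := bq w k
    have e6 : (1 : ℝ) ≤ (R ^ k * k !) * (Real.exp A * scaledWeight N A k) := by
      have := hone k
      nlinarith
    calc _ ≤ (R ^ k * k !) * (Real.exp A * scaledWeight N A k) +
          K * K * (K * K) * R ^ k * k ! * scaledWeight N A k := add_le_add (e3.trans e6) e5
      _ = _ := by ring
  refine ⟨fun w => g w * w⁻¹, ?_, ?_, ?_⟩
  · rw [contDiff_iff_contDiffAt]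
    intro w
    by_cases hw : w = 0
    · have : (fun w => g w * w⁻¹) =ᶠ[nhds w] fun _ => 0 := by
        subst hw
        filter_upwards [Metric.closedBall_mem_nhds (0 : ℂ) (by norm_num : (0 : ℝ) < 1 / 4)] with z hz
        simp [hg, hqone z (by simpa using hz)]
      exact contDiffAt_const.congr_of_eventuallyEq this
    · exact cg.contDiffAt.mul (contDiffAt_inv ℝ hw)
  · intro w hw
    simp [hg, hqzero w hw]
  · intro k w
    have hWk := hW k
    by_cases hw : ‖w‖ < 1 / 4
    · have : (fun w => g w * w⁻¹) =ᶠ[nhds w] fun _ => 0 := by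
        filter_upwards [(isOpen_lt continuous_norm continuous_const).mem_nhds hw] with z hz
        simp [hg, hqone z (le_of_lt hz)]
      rw [(this.iteratedFDeriv ℝ k).eq_of_nhds]
      have h0 : iteratedFDeriv ℝ k (fun _ : ℂ => (0 : ℂ)) w = 0 := by simp
      rw [h0, norm_zero]
      positivity
    · rw [not_lt] at hw
      have hw0 : w ≠ 0 := by rintro rfl; norm_num at hw
      have binv : ∀ k, ‖iteratedFDeriv ℝ k (fun z : ℂ => z⁻¹) w‖ ≤
          (8 * Real.exp A) * R ^ k * k ! * scaledWeight N A k := by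
        intro k
        have h1 := norm_iteratedFDeriv_real_inv_le hw k
        have h2 : (8 : ℝ) ^ k ≤ R ^ k := by gcongr; linarith
        calc _ ≤ 8 * R ^ k * k ! * 1 := by rw [mul_one]; exact h1.trans (by gcongr)
          _ ≤ 8 * R ^ k * k ! * (Real.exp A * scaledWeight N A k) := by
              gcongr; exact hone k
          _ = _ := by ring
      have := norm_iteratedFDeriv_mul_le_of_weights (S := {0}ᶜ) isOpen_compl_singleton
        cg.contDiffOn (fun z hz => (contDiffAt_inv ℝ hz).contDiffWithinAt) (x := w) hw0
        (by positivity : 0 ≤ R) (by positivity) (by positivity) hW hWm (bg w) binv k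
      refine this.trans ?_
      have e1 : (Real.exp A + K ^ 4) * (8 * Real.exp A) ≤
          (1 + C ^ 4) * 8 * Real.exp ((4 * C₀ + 2) * A) := by
        have h1 : K ^ 4 = C ^ 4 * Real.exp (4 * C₀ * A) := by
          rw [hK, mul_pow, ← Real.exp_nat_mul]; push_cast; ring_nf
        have h2 : Real.exp ((4 * C₀ + 2) * A) = Real.exp (4 * C₀ * A) * Real.exp A * Real.exp A := by
          rw [← Real.exp_add, ← Real.exp_add]; ring_nf
        have h3 : 1 ≤ Real.exp (4 * C₀ * A) := Real.one_le_exp (by positivity)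
        have h4 : 1 ≤ Real.exp A := Real.one_le_exp hA.le
        rw [h1, h2]
        have h5 : Real.exp A + C ^ 4 * Real.exp (4 * C₀ * A) ≤
            (1 + C ^ 4) * (Real.exp (4 * C₀ * A) * Real.exp A) := by
          have a1 : Real.exp A ≤ Real.exp (4 * C₀ * A) * Real.exp A :=
            le_mul_of_one_le_left (by positivity) h3
          have a2 : Real.exp (4 * C₀ * A) ≤ Real.exp (4 * C₀ * A) * Real.exp A :=
            le_mul_of_one_le_right (by positivity) h4
          have : C ^ 4 * Real.exp (4 * C₀ * A) ≤ C ^ 4 * (Real.exp (4 * C₀ * A) * Real.exp A) := by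
            gcongr
          linarith
        nlinarith [Real.exp_pos A]
      gcongr

/-- The four sides of the rectangle `[-X, X] × [-Y, Y]`, each parametrized by `[-1, 1]`. -/
noncomputable def rectSide (X Y : ℝ) : Fin 4 → ℝ → ℂ :=
  ![fun τ => X * τ - Y * Complex.I, fun τ => X * τ + Y * Complex.I,
    fun τ => X + Y * τ * Complex.I, fun τ => -X + Y * τ * Complex.I]

/-- The signed velocities along the sides `rectSide`, for the counterclockwise orientation. -/
noncomputable def rectWeight (X Y : ℝ) : Fin 4 → ℂ :=
  ![X, -X, Y * Complex.I, -(Y * Complex.I)]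

theorem Complex.log_I_mul_of_re_pos {w : ℂ} (hw : 0 < w.re) :
    Complex.log (Complex.I * w) = Real.pi / 2 * Complex.I + Complex.log w := by
  have hw0 : w ≠ 0 := by rintro rfl; simp at hw
  have h := Complex.abs_arg_lt_pi_div_two_iff.2 (Or.inl hw)
  rw [abs_lt] at h
  rw [Complex.log_mul Complex.I_ne_zero hw0, Complex.log_I]
  rw [Complex.arg_I]
  constructor <;> linarith [h.1, h.2, Real.pi_pos]

theorem integral_mul_I_div_add_eq {p c d : ℝ} (hp : 0 < p) :
    ∫ τ in (-1 : ℝ)..1, (c * Complex.I) / (p + (c * τ + d) * Complex.I) =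
      Complex.log (p + (c + d) * Complex.I) - Complex.log (p + (-c + d) * Complex.I) := by
  have hs : ∀ τ : ℝ, (p + (c * τ + d) * Complex.I : ℂ) ∈ Complex.slitPlane := by
    intro τ
    left; simpa using hp
  have hder : ∀ τ : ℝ, HasDerivAt (fun τ : ℝ => Complex.log (p + (c * τ + d) * Complex.I))
      ((c * Complex.I) / (p + (c * τ + d) * Complex.I)) τ := by
    intro τ
    have h1 : HasDerivAt (fun τ : ℝ => (τ : ℂ)) 1 τ := Complex.ofRealCLM.hasDerivAt
    have := (((h1.const_mul (c : ℂ)).add_const (d : ℂ)).mul_const Complex.I).const_add (p : ℂ)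
    exact HasDerivAt.clog_real (by simpa using this) (hs τ)
  rw [intervalIntegral.integral_eq_sub_of_hasDerivAt (fun τ _ => hder τ)]
  · simp
  · apply Continuous.intervalIntegrable
    apply Continuous.div (by fun_prop) (by fun_prop)
    exact fun τ => Complex.slitPlane_ne_zero (hs τ)

theorem rectSide_ne {X Y a : ℝ} (hY : 0 < Y) (ha : |a| < X) (i : Fin 4) (τ : ℝ) :
    rectSide X Y i τ - a ≠ 0 := by
  rw [abs_lt] at ha
  intro h
  fin_cases i <;> simp [rectSide, Complex.ext_iff] at h <;> linarith

theorem continuous_rectSide (X Y : ℝ) (i : Fin 4) : Continuous (rectSide X Y i) := by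
  fin_cases i <;> simp [rectSide] <;> fun_prop

theorem sum_integral_rect_inv {X Y a : ℝ} (hY : 0 < Y) (ha : |a| < X) :
    ∑ i, ∫ τ in (-1 : ℝ)..1, rectWeight X Y i * (rectSide X Y i τ - a)⁻¹ =
      2 * Real.pi * Complex.I := by
  have hne := rectSide_ne hY ha
  have ha' := abs_lt.1 ha
  have hp : 0 < X - a := by linarith
  have hq : 0 < X + a := by linarith
  have e0 := integral_mul_I_div_add_eq (c := X) (d := -a) hY
  have e1 := integral_mul_I_div_add_eq (c := X) (d := a) hY
  have e2 := integral_mul_I_div_add_eq (c := Y) (d := 0) hp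
  have e3 := integral_mul_I_div_add_eq (c := Y) (d := 0) hq
  have flip : ∀ f : ℝ → ℂ, ∫ τ in (-1 : ℝ)..1, f τ = ∫ τ in (-1 : ℝ)..1, f (-τ) := by
    intro f; simp
  have f0 : ∫ τ in (-1 : ℝ)..1, rectWeight X Y 0 * (rectSide X Y 0 τ - a)⁻¹ =
      ∫ τ in (-1 : ℝ)..1, (X * Complex.I) / (Y + (X * τ + (-a : ℝ)) * Complex.I) := by
    apply intervalIntegral.integral_congr
    intro τ _
    have h := hne 0 τ
    simp only [rectSide, rectWeight, Matrix.cons_val] at h ⊢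
    rw [show (Y + (X * τ + ((-a : ℝ) : ℂ)) * Complex.I : ℂ) =
      Complex.I * (X * τ - Y * Complex.I - a) by push_cast; linear_combination (Y : ℂ) * Complex.I_mul_I]
    rw [mul_comm (X : ℂ) Complex.I, mul_div_mul_left _ _ Complex.I_ne_zero, div_eq_mul_inv]
  have f1 : ∫ τ in (-1 : ℝ)..1, rectWeight X Y 1 * (rectSide X Y 1 τ - a)⁻¹ =
      ∫ τ in (-1 : ℝ)..1, (X * Complex.I) / (Y + (X * τ + (a : ℝ)) * Complex.I) := by
    rw [flip]
    apply intervalIntegral.integral_congr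
    intro τ _
    have h := hne 1 (-τ)
    simp only [rectSide, rectWeight, Matrix.cons_val] at h ⊢
    rw [show (Y + (X * τ + (a : ℂ)) * Complex.I : ℂ) =
      -Complex.I * (X * (-τ : ℝ) + Y * Complex.I - a) by
        push_cast; linear_combination (Y : ℂ) * Complex.I_mul_I]
    rw [show (X : ℂ) * Complex.I = -Complex.I * -X by ring,
      mul_div_mul_left _ _ (neg_ne_zero.2 Complex.I_ne_zero), div_eq_mul_inv]
  have f2 : ∫ τ in (-1 : ℝ)..1, rectWeight X Y 2 * (rectSide X Y 2 τ - a)⁻¹ =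
      ∫ τ in (-1 : ℝ)..1, (Y * Complex.I) / ((X - a : ℝ) + (Y * τ + (0 : ℝ)) * Complex.I) := by
    apply intervalIntegral.integral_congr
    intro τ _
    simp only [rectSide, rectWeight, Matrix.cons_val]
    rw [div_eq_mul_inv]
    push_cast
    ring_nf
  have f3 : ∫ τ in (-1 : ℝ)..1, rectWeight X Y 3 * (rectSide X Y 3 τ - a)⁻¹ =
      ∫ τ in (-1 : ℝ)..1, (Y * Complex.I) / ((X + a : ℝ) + (Y * τ + (0 : ℝ)) * Complex.I) := by
    rw [flip]
    apply intervalIntegral.integral_congr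
    intro τ _
    have h := hne 3 (-τ)
    simp only [rectSide, rectWeight, Matrix.cons_val] at h ⊢
    rw [show (((X + a : ℝ) : ℂ) + (Y * τ + (0 : ℝ)) * Complex.I : ℂ) =
      -(-X + Y * (-τ : ℝ) * Complex.I - a) by push_cast; ring]
    rw [div_neg, div_eq_mul_inv, neg_mul]
  rw [Fin.sum_univ_four, f0, f1, f2, f3, e0, e1, e2, e3]
  have l1 := Complex.log_I_mul_of_re_pos (w := (X - a : ℝ) - Y * Complex.I) (by simpa using ha'.2)
  have l2 := Complex.log_I_mul_of_re_pos (w := Y - (X - a : ℝ) * Complex.I) (by simpa using hY)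
  have l3 := Complex.log_I_mul_of_re_pos (w := (X + a : ℝ) - Y * Complex.I)
    (by simp; linarith)
  have l4 := Complex.log_I_mul_of_re_pos (w := Y - (X + a : ℝ) * Complex.I) (by simpa using hY)
  have m1 : ∀ u v : ℝ, Complex.I * (u - v * Complex.I) = v + u * Complex.I := by
    intro u v; linear_combination (-(v : ℂ)) * Complex.I_mul_I
  rw [m1] at l1 l2 l3 l4
  have n1 : (Y + (X + ((-a : ℝ) : ℂ)) * Complex.I : ℂ) = Y + (X - a : ℝ) * Complex.I := by
    push_cast; ring
  have n2 : (Y + (-X + ((-a : ℝ) : ℂ)) * Complex.I : ℂ) = Y - (X + a : ℝ) * Complex.I := by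
    push_cast; ring
  have n3 : (Y + (X + (a : ℂ)) * Complex.I : ℂ) = Y + (X + a : ℝ) * Complex.I := by
    push_cast; ring
  have n4 : (Y + (-X + (a : ℂ)) * Complex.I : ℂ) = Y - (X - a : ℝ) * Complex.I := by
    push_cast; ring
  rw [n1, n2, n3, n4, l1, l3]
  simp only [Complex.ofReal_zero, add_zero, neg_mul, ← sub_eq_add_neg]
  rw [l2, l4]
  ring

theorem sum_integral_rect_of_differentiable {X Y : ℝ} {u : ℂ → ℂ} (hu : Differentiable ℂ u) :
    ∑ i, ∫ τ in (-1 : ℝ)..1, rectWeight X Y i * u (rectSide X Y i τ) = 0 := by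
  have h := Complex.integral_boundary_rect_eq_zero_of_differentiableOn u
    (-X - Y * Complex.I) (X + Y * Complex.I) hu.differentiableOn
  simp only [Complex.sub_re, Complex.neg_re, Complex.ofReal_re, Complex.mul_re, Complex.I_re,
    mul_zero, Complex.ofReal_im, Complex.I_im, mul_one, sub_self, sub_zero, Complex.add_re,
    add_zero, Complex.sub_im, Complex.neg_im, Complex.mul_im, Complex.add_im, zero_add,
    neg_zero, zero_sub] at h
  have hX : ∀ f : ℝ → ℂ, ∫ x in (-X)..X, f x = X * ∫ τ in (-1 : ℝ)..1, f (X * τ) := by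
    intro f
    have := intervalIntegral.smul_integral_comp_mul_left f (a := -1) (b := 1) X
    rw [mul_neg_one, mul_one] at this
    rw [← this, Complex.real_smul]
  have hY : ∀ f : ℝ → ℂ, ∫ x in (-Y)..Y, f x = Y * ∫ τ in (-1 : ℝ)..1, f (Y * τ) := by
    intro f
    have := intervalIntegral.smul_integral_comp_mul_left f (a := -1) (b := 1) Y
    rw [mul_neg_one, mul_one] at this
    rw [← this, Complex.real_smul]
  rw [hX, hX, hY, hY] at h
  rw [Fin.sum_univ_four]
  simp only [intervalIntegral.integral_const_mul]
  simp only [rectSide, rectWeight, Matrix.cons_val]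
  push_cast at h
  simp only [smul_eq_mul, neg_mul, ← sub_eq_add_neg] at h ⊢
  linear_combination h

theorem sum_integral_rect_div {X Y a : ℝ} (hY : 0 < Y) (ha : |a| < X) {u : ℂ → ℂ}
    (hu : Differentiable ℂ u) :
    ∑ i, ∫ τ in (-1 : ℝ)..1, rectWeight X Y i * (u (rectSide X Y i τ) * (rectSide X Y i τ - a)⁻¹) =
      2 * Real.pi * Complex.I * u a := by
  have hd : Differentiable ℂ (dslope u a) := by
    have := (Complex.differentiableOn_dslope (f := u) (s := Set.univ) (c := (a : ℂ))
      Filter.univ_mem).2 hu.differentiableOn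
    exact differentiableOn_univ.1 this
  have h1 := sum_integral_rect_of_differentiable (X := X) (Y := Y) hd
  have h2 := sum_integral_rect_inv hY ha
  have key : ∀ i τ, rectWeight X Y i * (u (rectSide X Y i τ) * (rectSide X Y i τ - a)⁻¹) =
      rectWeight X Y i * dslope u a (rectSide X Y i τ) +
        u a * (rectWeight X Y i * (rectSide X Y i τ - a)⁻¹) := by
    intro i τ
    have hne := rectSide_ne hY ha i τ
    rw [dslope_of_ne _ (sub_ne_zero.1 hne), slope_def_field]
    field_simp
    ring
  have hc := continuous_rectSide X Y
  simp only [key]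
  have hadd : ∀ i, ∫ τ in (-1 : ℝ)..1, (rectWeight X Y i * dslope u a (rectSide X Y i τ) +
        u a * (rectWeight X Y i * (rectSide X Y i τ - a)⁻¹)) =
      (∫ τ in (-1 : ℝ)..1, rectWeight X Y i * dslope u a (rectSide X Y i τ)) +
      u a * ∫ τ in (-1 : ℝ)..1, rectWeight X Y i * (rectSide X Y i τ - a)⁻¹ := by
    intro i
    have c1 : Continuous fun τ => rectWeight X Y i * dslope u a (rectSide X Y i τ) :=
      continuous_const.mul (hd.continuous.comp (hc i))
    have c2 : Continuous fun τ => u a * (rectWeight X Y i * (rectSide X Y i τ - a)⁻¹) :=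
      continuous_const.mul (continuous_const.mul
        (((hc i).sub continuous_const).inv₀ (rectSide_ne hY ha i)))
    rw [intervalIntegral.integral_add (c1.intervalIntegrable _ _) (c2.intervalIntegrable _ _),
      intervalIntegral.integral_const_mul (u a)]
  simp only [hadd]
  rw [Finset.sum_add_distrib, h1, ← Finset.mul_sum, h2]
  ring

theorem exists_rpow_mul_exp_neg_le {c β : ℝ} (hc : 0 < c) (hβ : 0 < β) (r : ℝ) :
    ∃ C > (0 : ℝ), ∀ t ≥ (1 : ℝ), t ^ r * Real.exp (-(c * t ^ β)) ≤ C := by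
  obtain ⟨j, hj⟩ := exists_nat_ge (r / β)
  refine ⟨j ! / c ^ j, by positivity, fun t ht => ?_⟩
  have ht0 : 0 < t := by linarith
  have h1 : t ^ r ≤ (t ^ β) ^ j := by
    rw [← Real.rpow_natCast, ← Real.rpow_mul ht0.le]
    apply Real.rpow_le_rpow_of_exponent_le ht
    rw [div_le_iff₀ hβ] at hj; linarith
  have h2 := Real.pow_div_factorial_le_exp (c * t ^ β) (by positivity) j
  rw [div_le_iff₀ (by positivity), mul_pow] at h2
  have h3 : Real.exp (c * t ^ β) * Real.exp (-(c * t ^ β)) = 1 := by rw [← Real.exp_add]; simp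
  rw [le_div_iff₀ (by positivity)]
  calc t ^ r * Real.exp (-(c * t ^ β)) * c ^ j
      ≤ (t ^ β) ^ j * Real.exp (-(c * t ^ β)) * c ^ j := by gcongr
    _ = (c ^ j * (t ^ β) ^ j) * Real.exp (-(c * t ^ β)) := by ring
    _ ≤ (Real.exp (c * t ^ β) * j !) * Real.exp (-(c * t ^ β)) := by gcongr
    _ = (Real.exp (c * t ^ β) * Real.exp (-(c * t ^ β))) * j ! := by ring
    _ = j ! := by rw [h3, one_mul]

theorem integrable_exp_neg_one_add_norm_rpow {V : Type*} [NormedAddCommGroup V]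
    [InnerProductSpace ℝ V] [FiniteDimensional ℝ V] [MeasurableSpace V] [BorelSpace V]
    {c β : ℝ} (hc : 0 < c) (hβ : 0 < β) :
    MeasureTheory.Integrable (fun ξ : V => Real.exp (-(c * (1 + ‖ξ‖) ^ β))) := by
  set r : ℝ := Module.finrank ℝ V + 1
  obtain ⟨C, hC, h⟩ := exists_rpow_mul_exp_neg_le hc hβ r
  have hi : MeasureTheory.Integrable (fun ξ : V => C * (1 + ‖ξ‖) ^ (-r)) :=
    (integrable_one_add_norm (by simp [r])).const_mul C
  refine hi.mono' ?_ (Filter.Eventually.of_forall fun ξ => ?_)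
  · apply Measurable.aestronglyMeasurable
    fun_prop
  · have h1 : 1 ≤ 1 + ‖ξ‖ := by linarith [norm_nonneg ξ]
    have h2 := h _ h1
    rw [Real.norm_of_nonneg (Real.exp_pos _).le, Real.rpow_neg (by positivity), ← div_eq_mul_inv,
      le_div_iff₀ (by positivity), mul_comm]
    exact h2

theorem exists_norm_fourier_le_exp {V : Type*} [NormedAddCommGroup V]
    [InnerProductSpace ℝ V] [FiniteDimensional ℝ V] [MeasurableSpace V] [BorelSpace V]
    {h : V → ℂ} (hh : ContDiff ℝ (⊤ : ℕ∞) h) (hs : HasCompactSupport h) {δ C ρ : ℝ} (hδ : 0 < δ)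
    (hρ : 0 < ρ)
    (hb : ∀ k x, ‖iteratedFDeriv ℝ k h x‖ ≤ C * ρ ^ k * k ! * (k ! : ℝ) ^ δ) :
    ∃ C' > (0 : ℝ), ∃ c > (0 : ℝ), ∀ ξ, ‖FourierTransform.fourier h ξ‖ ≤
      C' * Real.exp (-(c * (1 + ‖ξ‖) ^ (1 + δ)⁻¹)) := by
  have hC : 0 ≤ C := by
    have := (norm_nonneg _).trans (hb 0 0); simpa using this
  set R : ℝ := max ρ 1 with hR
  have hR1 : 1 ≤ R := le_max_right _ _
  set β : ℝ := (1 + δ)⁻¹ with hβ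
  have hβ0 : 0 < β := by positivity
  have hβ1 : β ≤ 1 := inv_le_one_of_one_le₀ (by linarith)
  set S := tsupport h with hS
  have hSc : IsCompact S := hs
  set v : ℝ := (MeasureTheory.volume : MeasureTheory.Measure V).real S with hv
  have hv0 : 0 ≤ v := MeasureTheory.measureReal_nonneg
  have hcont : ∀ k, Continuous (iteratedFDeriv ℝ k h) := fun k =>
    hh.continuous_iteratedFDeriv (by exact_mod_cast le_top)
  have hsupp : ∀ k, HasCompactSupport (iteratedFDeriv ℝ k h) := fun k => hs.iteratedFDeriv k
  have h_int : ∀ k, MeasureTheory.Integrable (iteratedFDeriv ℝ k h) := fun k =>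
    (hcont k).integrable_of_hasCompactSupport (hsupp k)
  have hI : ∀ k, ∫ x, ‖iteratedFDeriv ℝ k h x‖ ≤ C * ρ ^ k * k ! * (k ! : ℝ) ^ δ * v := by
    intro k
    have e1 : ∫ x, ‖iteratedFDeriv ℝ k h x‖ = ∫ x in S, ‖iteratedFDeriv ℝ k h x‖ := by
      rw [MeasureTheory.setIntegral_eq_integral_of_forall_compl_eq_zero]
      intro x hx
      have : x ∉ tsupport (iteratedFDeriv ℝ k h) := fun hx' => hx (tsupport_iteratedFDeriv_subset k hx')
      rw [image_eq_zero_of_notMem_tsupport this, norm_zero]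
    rw [e1]
    have := MeasureTheory.norm_setIntegral_le_of_norm_le_const (μ := MeasureTheory.volume)
      (s := S) (f := fun x => ‖iteratedFDeriv ℝ k h x‖) (C := C * ρ ^ k * k ! * (k ! : ℝ) ^ δ)
      hSc.measure_lt_top (fun x _ => by rw [norm_norm]; exact hb k x)
    exact (le_abs_self _).trans this
  have hpow : ∀ (N : ℕ) (ξ : V), ‖ξ‖ ^ N * ‖FourierTransform.fourier h ξ‖ ≤
      (C * v) * (4 * R) ^ N * (N ! : ℝ) ^ (1 + δ) := by
    intro N ξ
    have h1 := Real.pow_mul_norm_iteratedFDeriv_fourier_le (K := 0) (N := (⊤ : ℕ∞)) hh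
      (fun k n hk _ => by
        have : k = 0 := by exact_mod_cast nonpos_iff_eq_zero.1 hk
        subst this
        simpa using (h_int n).norm) (k := 0) (n := N) le_rfl le_top ξ
    simp only [norm_iteratedFDeriv_zero] at h1
    refine h1.trans ?_
    have h2 : ∀ p ∈ Finset.range (0 + 1) ×ˢ Finset.range (N + 1),
        ∫ v : V, ‖v‖ ^ p.1 * ‖iteratedFDeriv ℝ p.2 h v‖ ≤ C * v * R ^ N * (N ! : ℝ) ^ (1 + δ) := by
      intro p hp
      rw [Finset.mem_product, Finset.mem_range, Finset.mem_range] at hp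
      have hp1 : p.1 = 0 := by omega
      have hp2 : p.2 ≤ N := by omega
      simp only [hp1, pow_zero, one_mul]
      refine (hI p.2).trans ?_
      have a1 : ρ ^ p.2 ≤ R ^ N := (pow_le_pow_left₀ hρ.le (le_max_left _ _) _).trans
        (pow_le_pow_right₀ hR1 hp2)
      have a2 : ((p.2)! : ℝ) ≤ N ! := by exact_mod_cast Nat.factorial_le hp2
      have a3 : ((N ! : ℕ) : ℝ) ^ (1 + δ) = N ! * (N ! : ℝ) ^ δ := by
        rw [Real.rpow_add (by positivity), Real.rpow_one]
      rw [a3]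
      calc C * ρ ^ p.2 * (p.2)! * ((p.2)! : ℝ) ^ δ * v ≤ C * R ^ N * N ! * (N ! : ℝ) ^ δ * v := by
            gcongr
        _ = _ := by ring
    have h3 := Finset.sum_le_card_nsmul _ _ _ h2
    have h4 : (Finset.range (0 + 1) ×ˢ Finset.range (N + 1)).card = N + 1 := by simp
    rw [h4, nsmul_eq_mul] at h3
    have h5 : ((N + 1 : ℕ) : ℝ) ≤ 2 ^ N := by exact_mod_cast Nat.lt_two_pow_self
    calc _ ≤ (2 * Real.pi) ^ 0 * (2 * ((0 : ℕ) : ℝ) + 2) ^ N *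
          (((N + 1 : ℕ) : ℝ) * (C * v * R ^ N * (N ! : ℝ) ^ (1 + δ))) := by gcongr
      _ ≤ (2 * Real.pi) ^ 0 * (2 * ((0 : ℕ) : ℝ) + 2) ^ N *
          (2 ^ N * (C * v * R ^ N * (N ! : ℝ) ^ (1 + δ))) := by gcongr
      _ = _ := by
          have h6 : (4 * R) ^ N = 2 ^ N * 2 ^ N * R ^ N := by
            rw [← mul_pow, ← mul_pow]; norm_num
          rw [h6, Nat.cast_zero, mul_zero, zero_add, pow_zero]
          ring
  set a : ℝ := (4 * R) ^ β with ha
  have ha0 : 0 < a := by positivity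
  set D : ℝ := (C * v) ^ β with hD
  have hD0 : 0 ≤ D := by positivity
  have hmain : ∀ ξ, ‖FourierTransform.fourier h ξ‖ ≤
      (2 * D) ^ (1 + δ) * Real.exp (-((1 + δ) / (2 * a) * ‖ξ‖ ^ β)) := by
    intro ξ
    set F : ℝ := ‖FourierTransform.fourier h ξ‖ with hF
    have hF0 : 0 ≤ F := norm_nonneg _
    set t : ℝ := ‖ξ‖ ^ β with ht
    have ht0 : 0 ≤ t := by positivity
    have hterm : ∀ N : ℕ, (t / (2 * a)) ^ N / N ! * F ^ β ≤ D * (1 / 2) ^ N := by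
      intro N
      have h1 := Real.rpow_le_rpow (by positivity) (hpow N ξ) hβ0.le
      rw [Real.mul_rpow (by positivity) hF0, Real.mul_rpow (by positivity) (by positivity),
        Real.mul_rpow (by positivity) (by positivity), ← Real.rpow_mul (by positivity),
        show (1 + δ) * β = 1 from mul_inv_cancel₀ (by positivity), Real.rpow_one,
        ← Real.rpow_natCast ‖ξ‖, ← Real.rpow_natCast (4 * R), ← Real.rpow_mul (by positivity),
        ← Real.rpow_mul (by positivity), mul_comm (N : ℝ), Real.rpow_mul (by positivity),
        Real.rpow_mul (by positivity), Real.rpow_natCast, Real.rpow_natCast] at h1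
      rw [div_pow, mul_pow, div_div, div_mul_eq_mul_div, div_le_iff₀ (by positivity)]
      calc t ^ N * F ^ β ≤ D * a ^ N * N ! := h1
        _ = D * ((1 / 2) ^ N * 2 ^ N) * a ^ N * N ! := by rw [← mul_pow]; norm_num
        _ = _ := by ring
    have hsum : Real.exp (t / (2 * a)) * F ^ β ≤ 2 * D := by
      have s1 : HasSum (fun N : ℕ => (t / (2 * a)) ^ N / N !) (Real.exp (t / (2 * a))) := by
        rw [Real.exp_eq_exp_ℝ]; exact NormedSpace.expSeries_div_hasSum_exp _
      have s2 := hasSum_geometric_two.mul_left D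
      have := hasSum_le hterm (s1.mul_right (F ^ β)) s2
      linarith
    have h2 : F ^ β ≤ 2 * D * Real.exp (-(t / (2 * a))) := by
      have h3 : Real.exp (t / (2 * a)) * Real.exp (-(t / (2 * a))) = 1 := by
        rw [← Real.exp_add]; simp
      calc F ^ β = (Real.exp (t / (2 * a)) * F ^ β) * Real.exp (-(t / (2 * a))) := by
            rw [mul_right_comm, h3, one_mul]
        _ ≤ _ := by gcongr
    have h4 := Real.rpow_le_rpow (by positivity) h2 (by positivity : 0 ≤ 1 + δ)
    rw [← Real.rpow_mul hF0, show β * (1 + δ) = 1 from inv_mul_cancel₀ (by positivity),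
      Real.rpow_one, Real.mul_rpow (by positivity) (by positivity), ← Real.exp_mul] at h4
    convert h4 using 3
    ring
  set c : ℝ := (1 + δ) / (2 * a) with hc
  have hc0 : 0 < c := by positivity
  refine ⟨((2 * D) ^ (1 + δ) + 1) * Real.exp c, by positivity, c, hc0, fun ξ => ?_⟩
  refine (hmain ξ).trans ?_
  have h1 : (1 + ‖ξ‖) ^ β ≤ 1 + ‖ξ‖ ^ β := by
    have := Real.rpow_add_le_add_rpow zero_le_one (norm_nonneg ξ) hβ0.le hβ1
    simpa using this
  have h2 : Real.exp (-(c * ‖ξ‖ ^ β)) ≤ Real.exp c * Real.exp (-(c * (1 + ‖ξ‖) ^ β)) := by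
    rw [← Real.exp_add]
    apply Real.exp_le_exp.2
    nlinarith
  calc _ ≤ ((2 * D) ^ (1 + δ) + 1) * (Real.exp c * Real.exp (-(c * (1 + ‖ξ‖) ^ β))) := by
        gcongr; linarith
    _ = _ := by ring

theorem scaledWeight_mul_rpow_le {N : ℕ} {s a ν : ℝ} (hs : (1 : ℝ) / N ≤ s) (ha : 0 < a)
    (hν : 0 < ν) (k : ℕ) :
    scaledWeight N (a * ν) k * (ν ^ s) ^ k ≤
      Real.exp (s * (a * ν)) * (a ^ (-s)) ^ k * (k ! : ℝ) ^ s := by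
  set A := a * ν with hA
  have hA0 : 0 < A := by positivity
  set e : ℝ := (1 : ℝ) / N with he
  have he0 : 0 ≤ e := by positivity
  have h1 := Real.pow_div_factorial_le_exp A hA0.le k
  rw [div_le_iff₀ (by positivity)] at h1
  have h2 : (ν ^ s) ^ k = (A ^ k) ^ s * (a ^ (-s)) ^ k := by
    have : ν = A * a⁻¹ := by rw [hA]; field_simp
    rw [← Real.rpow_natCast, ← Real.rpow_natCast, ← Real.rpow_natCast, ← Real.rpow_mul hν.le,
      ← Real.rpow_mul hA0.le, ← Real.rpow_mul ha.le, mul_comm s, this,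
      Real.mul_rpow hA0.le (by positivity), Real.inv_rpow ha.le, ← Real.rpow_neg ha.le]
    ring_nf
  have h3 : scaledWeight N A k = (k ! : ℝ) ^ e * (A ^ k) ^ (-e) := by
    rw [scaledWeight, Real.div_rpow (by positivity) (by positivity), Real.rpow_neg (by positivity),
      div_eq_mul_inv]
  have h4 : (A ^ k) ^ (-e) * (A ^ k) ^ s = (A ^ k) ^ (s - e) := by
    rw [← Real.rpow_add (by positivity)]; ring_nf
  have h5 : (A ^ k) ^ (s - e) ≤ (Real.exp A * k !) ^ (s - e) :=
    Real.rpow_le_rpow (by positivity) h1 (by linarith)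
  have h6 : (Real.exp A * k !) ^ (s - e) ≤ Real.exp (s * A) * (k ! : ℝ) ^ (s - e) := by
    rw [Real.mul_rpow (by positivity) (by positivity), ← Real.exp_mul]
    exact mul_le_mul_of_nonneg_right (Real.exp_le_exp.2 (by nlinarith)) (by positivity)
  calc scaledWeight N A k * (ν ^ s) ^ k
      = (k ! : ℝ) ^ e * ((A ^ k) ^ (-e) * (A ^ k) ^ s) * (a ^ (-s)) ^ k := by rw [h2, h3]; ring
    _ ≤ (k ! : ℝ) ^ e * (Real.exp (s * A) * (k ! : ℝ) ^ (s - e)) * (a ^ (-s)) ^ k := by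
        rw [h4]; gcongr; exact h5.trans h6
    _ = Real.exp (s * A) * (a ^ (-s)) ^ k * ((k ! : ℝ) ^ e * (k ! : ℝ) ^ (s - e)) := by ring
    _ = _ := by rw [← Real.rpow_add (by positivity)]; ring_nf

theorem norm_iteratedFDeriv_clm_le {E F : Type*} [NormedAddCommGroup E] [NormedSpace ℝ E]
    [NormedAddCommGroup F] [NormedSpace ℝ F] (L : E →L[ℝ] F) {r : ℝ} (hr : 0 ≤ r) {x : E}
    (hx : ‖x‖ ≤ r)
    (k : ℕ) : ‖iteratedFDeriv ℝ k (fun y => L y) x‖ ≤ ‖L‖ * (1 + r) := by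
  have hL := norm_nonneg L
  have hd : fderiv ℝ (fun y => L y) = fun _ => L := funext fun y => L.fderiv
  rcases k with _ | _ | k
  · rw [norm_iteratedFDeriv_zero]
    have := L.le_opNorm x
    nlinarith
  · rw [← norm_iteratedFDeriv_fderiv]
    rw [hd, norm_iteratedFDeriv_zero]
    nlinarith
  · rw [← norm_iteratedFDeriv_fderiv]
    rw [hd, iteratedFDeriv_const_of_ne (by simp)]
    simp only [Pi.zero_apply, norm_zero]
    positivity

theorem factorial_rpow_mul_le {s : ℝ} (hs : 0 ≤ s) (i j : ℕ) :
    (i ! : ℝ) ^ s * (j ! : ℝ) ^ s ≤ ((i + j)! : ℝ) ^ s := by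
  rw [← Real.mul_rpow (by positivity) (by positivity)]
  apply Real.rpow_le_rpow (by positivity) _ hs
  exact_mod_cast Nat.le_of_dvd (Nat.factorial_pos _)
    (Nat.factorial_mul_factorial_dvd_factorial_add i j)

theorem one_le_factorial_rpow {s : ℝ} (hs : 0 ≤ s) (k : ℕ) : 1 ≤ (k ! : ℝ) ^ s :=
  Real.one_le_rpow (by exact_mod_cast Nat.factorial_pos k) hs

theorem norm_iteratedFDeriv_kernel_le {E : Type*} [NormedAddCommGroup E] [NormedSpace ℝ E]
    {N : ℕ} {s a ν C C₀ ρ Λ ε r : ℝ} (hs : (1 : ℝ) / N ≤ s) (ha : 0 < a) (hν : 0 < ν)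
    (hC : 0 ≤ C) (hρ : 0 ≤ ρ) (hr : 0 ≤ r) (hΛ : 0 ≤ Λ) {Ψ : ℂ → ℂ} (hΨ : ContDiff ℝ (⊤ : ℕ∞) Ψ)
    (hb : ∀ k w, ‖iteratedFDeriv ℝ k Ψ w‖ ≤
        C * Real.exp (C₀ * (a * ν)) * ρ ^ k * k ! * scaledWeight N (a * ν) k)
    (P P' : E →L[ℝ] ℂ) (hP : ‖ε⁻¹ • P‖ ≤ Λ * ν ^ s) (κ : ℂ) (k : ℕ) {x : E} (hx : ‖x‖ ≤ r) :
    ‖iteratedFDeriv ℝ k (fun b => κ * (Ψ (ε⁻¹ • P b) * P' b)) x‖ ≤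
      ‖κ‖ * (C * Real.exp ((C₀ + s) * (a * ν)) * (‖P'‖ * (1 + r)) *
        (2 * max 1 (ρ * Λ * a ^ (-s))) ^ k * k ! * (k ! : ℝ) ^ s) := by
  have hs0 : 0 ≤ s := le_trans (by positivity) hs
  set R := max 1 (ρ * Λ * a ^ (-s)) with hR
  have hR1 : 1 ≤ R := le_max_left _ _
  have hc0 : ContDiff ℝ (⊤ : ℕ∞) (fun b => ε⁻¹ • P b) := (ε⁻¹ • P).contDiff
  have hc1 : ContDiff ℝ (⊤ : ℕ∞) (fun b => Ψ (ε⁻¹ • P b)) :=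
    hΨ.comp hc0
  have hc2 : ContDiff ℝ (⊤ : ℕ∞) (fun b => P' b) := P'.contDiff
  have h1 : ∀ k, ‖iteratedFDeriv ℝ k (fun b => Ψ (ε⁻¹ • P b)) x‖ ≤
      (C * Real.exp ((C₀ + s) * (a * ν))) * R ^ k * k ! * (k ! : ℝ) ^ s := by
    intro k
    have h := norm_iteratedFDeriv_comp_affine_le hΨ (ε⁻¹ • P) 0 k x
    simp only [add_zero, _root_.smul_apply] at h
    refine h.trans ?_
    have hw := scaledWeight_nonneg N (mul_pos ha hν) k
    calc _ ≤ (C * Real.exp (C₀ * (a * ν)) * ρ ^ k * k ! * scaledWeight N (a * ν) k) *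
          (Λ * ν ^ s) ^ k := by
          gcongr
          exact hb k _
      _ = (C * Real.exp (C₀ * (a * ν))) * (ρ ^ k * Λ ^ k) * k ! *
          (scaledWeight N (a * ν) k * (ν ^ s) ^ k) := by rw [mul_pow]; ring
      _ ≤ (C * Real.exp (C₀ * (a * ν))) * (ρ ^ k * Λ ^ k) * k ! *
          (Real.exp (s * (a * ν)) * (a ^ (-s)) ^ k * (k ! : ℝ) ^ s) := by
          exact mul_le_mul_of_nonneg_left (scaledWeight_mul_rpow_le hs ha hν k) (by positivity)
      _ = (C * (Real.exp (C₀ * (a * ν)) * Real.exp (s * (a * ν)))) * (ρ * Λ * a ^ (-s)) ^ k * k ! *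
          (k ! : ℝ) ^ s := by rw [mul_pow, mul_pow]; ring
      _ ≤ (C * (Real.exp (C₀ * (a * ν)) * Real.exp (s * (a * ν)))) * R ^ k * k ! *
          (k ! : ℝ) ^ s := by
          gcongr
          exact le_max_right _ _
      _ = _ := by rw [← Real.exp_add]; ring_nf
  have h2 : ∀ k, ‖iteratedFDeriv ℝ k (fun b => P' b) x‖ ≤
      (‖P'‖ * (1 + r)) * R ^ k * k ! * (1 : ℝ) := by
    intro k
    refine (norm_iteratedFDeriv_clm_le P' hr hx k).trans ?_
    have e1 : (1 : ℝ) ≤ R ^ k := one_le_pow₀ hR1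
    have e2 : (1 : ℝ) ≤ k ! := by exact_mod_cast Nat.factorial_pos k
    rw [mul_one, mul_assoc _ (R ^ k)]
    exact le_mul_of_one_le_right (by positivity) (one_le_mul_of_one_le_of_one_le e1 e2)
  have h3 := norm_iteratedFDeriv_mul_le_of_weights isOpen_univ hc1.contDiffOn hc2.contDiffOn
    (Set.mem_univ x) (by positivity : 0 ≤ R) (by positivity) (by positivity)
    (M := fun k => (k ! : ℝ) ^ s) (M' := fun _ => 1) (M'' := fun k => (k ! : ℝ) ^ s)
    (fun k => by positivity)
    (fun i j => by
      rw [mul_one]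
      exact (le_mul_of_one_le_right (by positivity) (one_le_factorial_rpow hs0 j)).trans
        (factorial_rpow_mul_le hs0 i j)) h1 h2 k
  have h4 : iteratedFDeriv ℝ k (fun b => κ * (Ψ (ε⁻¹ • P b) * P' b)) x =
      κ • iteratedFDeriv ℝ k (fun b => (Ψ (ε⁻¹ • P b) * P' b)) x := by
    have := iteratedFDeriv_const_smul_apply (𝕜 := ℝ) (i := k) (a := κ) (x := x)
      (f := fun b => (Ψ (ε⁻¹ • P b) * P' b))
      ((hc1.mul hc2).contDiffAt.of_le (by exact_mod_cast le_top))
    exact this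
  rw [h4, norm_smul]
  gcongr

theorem norm_iteratedFDeriv_integral_le {α ι F : Type*} [MeasurableSpace α]
    {μ : MeasureTheory.Measure α} [Fintype ι]
    [NormedAddCommGroup F] [NormedSpace ℝ F] [CompleteSpace F] {K : α → (ι → ℝ) → F}
    (hK : ∀ a, ContDiff ℝ (⊤ : ℕ∞) (K a))
    (hmeas : ∀ b, MeasureTheory.StronglyMeasurable (fun a => K a b))
    {B : α → ℝ} (hB : MeasureTheory.Integrable B μ) {w : ℕ → ℝ}
    (hbound : ∀ a k r b, 0 ≤ r → ‖b‖ ≤ r → ‖iteratedFDeriv ℝ k (K a) b‖ ≤ B a * ((1 + r) * w k)) :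
    ContDiff ℝ (⊤ : ℕ∞) (fun b => ∫ a, K a b ∂μ) ∧
      ∀ k r b, 0 ≤ r → ‖b‖ ≤ r →
        ‖iteratedFDeriv ℝ k (fun b => ∫ a, K a b ∂μ) b‖ ≤ (∫ a, B a ∂μ) * ((1 + r) * w k) := by
  obtain ⟨h1, h2⟩ := contDiff_integral_of_dominated (μ := μ) hK
    (fun k b => (stronglyMeasurable_iteratedFDeriv_param hK hmeas k b).aestronglyMeasurable)
    (fun r k => ⟨fun a => B a * ((1 + |r|) * w k), hB.mul_const _, fun a b hb =>
      hbound a k |r| b (abs_nonneg r) (hb.trans (le_abs_self r))⟩)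
  refine ⟨h1, fun k r b hr hb => ?_⟩
  rw [h2, ← MeasureTheory.integral_mul_const]
  exact MeasureTheory.norm_integral_le_of_norm_le (hB.mul_const _)
    (Filter.Eventually.of_forall fun a => hbound a k r b hr hb)

theorem le_norm_rectSide_sub {X Y a : ℝ} (ha : Y ≤ X - |a|) (i : Fin 4) (τ : ℝ) : Y ≤ ‖rectSide X Y i τ - a‖ := by
  have h1 := Complex.abs_im_le_norm (rectSide X Y i τ - a)
  have h2 := Complex.abs_re_le_norm (rectSide X Y i τ - a)
  have h3 := abs_le.1 (le_refl |a|)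
  rw [abs_le] at h1 h2
  fin_cases i <;> simp [rectSide] at h1 h2 ⊢ <;> linarith

theorem norm_rectSide_le {X Y : ℝ} (hX : 0 ≤ X) (hY : 0 ≤ Y) (i : Fin 4) {τ : ℝ} (hτ : |τ| ≤ 1) :
    ‖rectSide X Y i τ‖ ≤ X + Y := by
  have h1 := Complex.norm_le_abs_re_add_abs_im (rectSide X Y i τ)
  have h2 : X * |τ| ≤ X := mul_le_of_le_one_right hX hτ
  have h3 : Y * |τ| ≤ Y := mul_le_of_le_one_right hY hτ
  fin_cases i <;> simp [rectSide, abs_mul, abs_of_nonneg hX, abs_of_nonneg hY] at h1 ⊢ <;> linarith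

theorem neg_le_im_rectSide {X Y : ℝ} (hY : 0 ≤ Y) (i : Fin 4) {τ : ℝ} (hτ : |τ| ≤ 1) :
    -Y ≤ (rectSide X Y i τ).im := by
  rw [abs_le] at hτ
  fin_cases i <;> simp [rectSide] <;> nlinarith

theorem norm_rectWeight_le {X Y : ℝ} (hX : 0 ≤ X) (hY : 0 ≤ Y) (i : Fin 4) :
    ‖rectWeight X Y i‖ ≤ X + Y := by
  fin_cases i <;> simp [rectWeight, abs_of_nonneg hX, abs_of_nonneg hY] <;> linarith

theorem continuous_rectSide_uncurry (i : Fin 4) :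
    Continuous (fun q : ℝ × ℝ × ℝ => rectSide q.1 q.2.1 i q.2.2) := by
  fin_cases i <;> simp [rectSide] <;> fun_prop

theorem continuous_rectWeight (i : Fin 4) :
    Continuous (fun q : ℝ × ℝ => rectWeight q.1 q.2 i) := by
  fin_cases i <;> simp [rectWeight] <;> fun_prop

theorem sum_integral_rect_sum_div {ι : Type*} [Fintype ι] {X Y : ℝ} {a : ι → ℝ} (hY : 0 < Y)
    (ha : ∀ g, |a g| < X) {u : ℂ → ℂ} (hu : Differentiable ℂ u) :
    ∑ i, ∫ τ in (-1 : ℝ)..1, rectWeight X Y i *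
        (u (rectSide X Y i τ) * ∑ g, (rectSide X Y i τ - a g)⁻¹) =
      2 * Real.pi * Complex.I * ∑ g, u (a g) := by
  have hc : ∀ i g, Continuous fun τ =>
      rectWeight X Y i * (u (rectSide X Y i τ) * (rectSide X Y i τ - a g)⁻¹) := fun i g => by
    have h1 := continuous_rectSide X Y i
    exact continuous_const.mul ((hu.continuous.comp h1).mul
      ((h1.sub continuous_const).inv₀ fun τ => rectSide_ne hY (ha g) i τ))
  rw [Finset.mul_sum, ← Finset.sum_congr rfl fun g _ => sum_integral_rect_div hY (ha g) hu,
    Finset.sum_comm]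
  refine Finset.sum_congr rfl fun i _ => ?_
  rw [← intervalIntegral.integral_finsetSum fun g _ => (hc i g).intervalIntegrable _ _]
  simp only [Finset.mul_sum]

theorem abs_max_min_le_one (τ : ℝ) : |max (-1) (min 1 τ)| ≤ 1 :=
  abs_le.2 ⟨le_max_left _ _, max_le (by norm_num) (min_le_left _ _)⟩

theorem logDeriv_eq_sum_inv {ι : Type*} [Fintype ι] {p : ℂ → ℂ} {p' z : ℂ} {a : ι → ℂ}
    (hp : ∀ z, p z = ∏ g, (z - a g)) (hd : HasDerivAt p p' z) (hz : ∀ g, z - a g ≠ 0) :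
    (p z)⁻¹ * p' = ∑ g, (z - a g)⁻¹ := by
  have h1 : logDeriv p z = ∑ g, (z - a g)⁻¹ := by
    have : p = fun z => ∏ g, (z - a g) := funext hp
    rw [this, logDeriv_prod (s := Finset.univ) (f := fun g z => z - a g) (fun g _ => hz g)
      (fun g _ => by fun_prop)]
    refine Finset.sum_congr rfl fun g _ => ?_
    simp [logDeriv_apply]
  rw [← h1, logDeriv_apply, hd.deriv]
  ring

/-- The integrand, over the `i`-th side of the rectangle with half-sides `X ξ`, `Y ξ`, of the
regularized Cauchy integral attached to the pencil of polynomials `z ↦ P ξ z b`. -/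
noncomputable def rectKernel {V E : Type*} [NormedAddCommGroup E] [NormedSpace ℝ E]
    (Ψ : ℕ → ℂ → ℂ) (P P' : V → ℂ → E →L[ℝ] ℂ) (η : V → ℂ) (X Y ε : V → ℝ) (j : V → ℕ)
    (i : Fin 4) (q : V × ℝ) (b : E) : ℂ :=
  η q.1 * rectWeight (X q.1) (Y q.1) i *
      Complex.exp (2 * Real.pi * Complex.I * rectSide (X q.1) (Y q.1) i (max (-1) (min 1 q.2))) *
      ((ε q.1)⁻¹ : ℝ) *
    (Ψ (j q.1) ((ε q.1)⁻¹ • P q.1 (rectSide (X q.1) (Y q.1) i (max (-1) (min 1 q.2))) b) *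
      P' q.1 (rectSide (X q.1) (Y q.1) i (max (-1) (min 1 q.2))) b)

theorem stronglyMeasurable_rectKernel {V E : Type*} [NormedAddCommGroup V] [NormedSpace ℝ V]
    [FiniteDimensional ℝ V] [MeasurableSpace V] [BorelSpace V]
    [NormedAddCommGroup E] [NormedSpace ℝ E]
    {Ψ : ℕ → ℂ → ℂ} (hΨ : ∀ j, Continuous (Ψ j)) {P P' : V → ℂ → E →L[ℝ] ℂ}
    (hP : ∀ b, Continuous fun q : V × ℂ => P q.1 q.2 b)
    (hP' : ∀ b, Continuous fun q : V × ℂ => P' q.1 q.2 b) {η : V → ℂ} (hη : Measurable η)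
    {X Y ε : V → ℝ} (hX : Measurable X) (hY : Measurable Y) (hε : Measurable ε) {j : V → ℕ}
    (hj : Measurable j) (i : Fin 4) (b : E) :
    MeasureTheory.StronglyMeasurable fun q => rectKernel Ψ P P' η X Y ε j i q b := by
  have : ProperSpace V := FiniteDimensional.proper ℝ V
  apply Measurable.stronglyMeasurable
  have hz : Measurable fun q : V × ℝ => rectSide (X q.1) (Y q.1) i (max (-1) (min 1 q.2)) := by
    have h := (continuous_rectSide_uncurry i).measurable
    exact h.comp (g := fun q : ℝ × ℝ × ℝ => rectSide q.1 q.2.1 i q.2.2)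
      (f := fun q : V × ℝ => (X q.1, Y q.1, max (-1) (min 1 q.2))) (by fun_prop)
  have hw : Measurable fun q : V × ℝ => rectWeight (X q.1) (Y q.1) i := by
    have h := (continuous_rectWeight i).measurable
    exact h.comp (g := fun q : ℝ × ℝ => rectWeight q.1 q.2 i)
      (f := fun q : V × ℝ => (X q.1, Y q.1)) (by fun_prop)
  have hPz : Measurable fun q : V × ℝ =>
      P q.1 (rectSide (X q.1) (Y q.1) i (max (-1) (min 1 q.2))) b :=
    (hP b).measurable.comp (measurable_fst.prodMk hz)
  have hPz' : Measurable fun q : V × ℝ =>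
      P' q.1 (rectSide (X q.1) (Y q.1) i (max (-1) (min 1 q.2))) b :=
    (hP' b).measurable.comp (measurable_fst.prodMk hz)
  have hΨm : Measurable fun p : ℕ × ℂ => Ψ p.1 p.2 :=
    measurable_from_prod_countable_right fun k => (hΨ k).measurable
  have hΨz : Measurable fun q : V × ℝ => Ψ (j q.1)
      ((ε q.1)⁻¹ • P q.1 (rectSide (X q.1) (Y q.1) i (max (-1) (min 1 q.2))) b) :=
    hΨm.comp ((hj.comp measurable_fst).prodMk ((hε.comp measurable_fst).inv.smul hPz))
  unfold rectKernel
  have hexp : Measurable fun q : V × ℝ => Complex.exp (2 * Real.pi * Complex.I *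
      rectSide (X q.1) (Y q.1) i (max (-1) (min 1 q.2))) :=
    Complex.measurable_exp.comp (hz.const_mul _)
  have he : Measurable fun q : V × ℝ => (((ε q.1)⁻¹ : ℝ) : ℂ) :=
    Complex.measurable_ofReal.comp (hε.comp measurable_fst).inv
  exact ((((hη.comp measurable_fst).mul hw).mul hexp).mul he).mul (hΨz.mul hPz')

theorem sum_integral_rectKernel {V E ι : Type*} [Fintype ι] [NormedAddCommGroup E]
    [NormedSpace ℝ E] {Ψ : ℕ → ℂ → ℂ} (hΨ : ∀ j w, 1 ≤ ‖w‖ → Ψ j w = w⁻¹)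
    {P P' : V → ℂ → E →L[ℝ] ℂ} (hd : ∀ ξ z b, HasDerivAt (fun z => P ξ z b) (P' ξ z b) z)
    {η : V → ℂ} {X Y ε : V → ℝ} {j : V → ℕ} {ξ : V} {b : E} {a : ι → ℝ}
    (hP : ∀ z, P ξ z b = ∏ g, (z - (a g : ℂ))) (hY : 0 < Y ξ) (hε : ε ξ = Y ξ ^ Fintype.card ι)
    (ha : ∀ g, Y ξ ≤ X ξ - |a g|) :
    ∑ i, ∫ τ in Set.Ioc (-1 : ℝ) 1, rectKernel Ψ P P' η X Y ε j i (ξ, τ) b =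
      η ξ * (2 * Real.pi * Complex.I * ∑ g, Complex.exp (2 * Real.pi * Complex.I * a g)) := by
  rw [← sum_integral_rect_sum_div (X := X ξ) hY (fun g => by linarith [ha g])
    (u := fun z => Complex.exp (2 * Real.pi * Complex.I * z)) (by fun_prop), Finset.mul_sum]
  refine Finset.sum_congr rfl fun i _ => ?_
  rw [intervalIntegral.integral_of_le (by norm_num), ← MeasureTheory.integral_const_mul]
  refine MeasureTheory.setIntegral_congr_fun measurableSet_Ioc fun τ hτ => ?_
  have hcl : max (-1) (min 1 τ) = τ := by
    rw [min_eq_right hτ.2, max_eq_right hτ.1.le]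
  have hε0 : 0 < ε ξ := hε ▸ pow_pos hY _
  simp only [rectKernel, hcl]
  set z := rectSide (X ξ) (Y ξ) i τ with hz
  have hza : ∀ g, Y ξ ≤ ‖z - a g‖ := fun g => le_norm_rectSide_sub (ha g) i τ
  have hne : ∀ g, z - a g ≠ 0 := fun g => norm_pos_iff.1 (hY.trans_le (hza g))
  have hge : ε ξ ≤ ‖P ξ z b‖ := by
    rw [hP, norm_prod, hε, ← Finset.card_univ, ← Finset.prod_const]
    exact Finset.prod_le_prod (fun g _ => hY.le) fun g _ => hza g
  have h1 : 1 ≤ ‖(ε ξ)⁻¹ • P ξ z b‖ := by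
    rw [norm_smul, norm_inv, Real.norm_of_nonneg hε0.le, ← div_eq_inv_mul, le_div_iff₀ hε0,
      one_mul]
    exact hge
  rw [hΨ _ _ h1, ← logDeriv_eq_sum_inv hP (hd ξ z b) hne]
  have hεc : (ε ξ : ℂ) ≠ 0 := by exact_mod_cast hε0.ne'
  rw [Complex.real_smul, mul_inv, Complex.ofReal_inv, inv_inv]
  field_simp

theorem exists_absorbing_constants {c₁ β D : ℝ} (hc₁ : 0 < c₁) (hβ : 0 < β) (hD : 0 < D) (m : ℕ) :
    ∃ c > (0 : ℝ), c ≤ 1 / 2 ∧ ∃ a > (0 : ℝ), ∃ C > (0 : ℝ), ∀ t ≥ (1 : ℝ), ∀ ν ≤ 2 * t ^ β,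
      t ^ m * Real.exp (-(c₁ * t ^ β)) * Real.exp (2 * Real.pi * (c * ν)) *
        Real.exp (D * (a * ν)) ≤ C * Real.exp (-(c₁ / 2 * t ^ β)) := by
  obtain ⟨C, hC, h⟩ := exists_rpow_mul_exp_neg_le (c := c₁ / 4) (by positivity) hβ m
  have hpi := Real.pi_pos
  refine ⟨min (1 / 2) (c₁ / (32 * Real.pi)), by positivity, min_le_left _ _, c₁ / (16 * D),
    by positivity, C, hC, fun t ht ν hν => ?_⟩
  set c := min (1 / 2) (c₁ / (32 * Real.pi)) with hc
  have hc0 : 0 < c := by positivity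
  have hcle : c ≤ c₁ / (32 * Real.pi) := min_le_right _ _
  have ht0 : 0 < t ^ β := by positivity
  have h' := h t ht
  rw [Real.rpow_natCast] at h'
  have e1 : 2 * Real.pi * (c * ν) ≤ c₁ / 8 * t ^ β := by
    have : 2 * Real.pi * c ≤ c₁ / 16 := by
      rw [le_div_iff₀ (by positivity)] at hcle; linarith
    calc 2 * Real.pi * (c * ν) ≤ 2 * Real.pi * (c * (2 * t ^ β)) := by gcongr
      _ = (2 * Real.pi * c) * (2 * t ^ β) := by ring
      _ ≤ c₁ / 16 * (2 * t ^ β) := by gcongr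
      _ = _ := by ring
  have e2 : D * (c₁ / (16 * D) * ν) ≤ c₁ / 8 * t ^ β := by
    calc D * (c₁ / (16 * D) * ν) ≤ D * (c₁ / (16 * D) * (2 * t ^ β)) := by gcongr
      _ = _ := by field_simp; ring
  calc _ = t ^ m * Real.exp (-(c₁ * t ^ β) + 2 * Real.pi * (c * ν) + D * (c₁ / (16 * D) * ν)) := by
        rw [Real.exp_add, Real.exp_add]; ring
    _ ≤ t ^ m * Real.exp (-(c₁ / 4 * t ^ β) + -(c₁ / 2 * t ^ β)) := by
        exact mul_le_mul_of_nonneg_left (Real.exp_le_exp.2 (by linarith)) (by positivity)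
    _ = (t ^ m * Real.exp (-(c₁ / 4 * t ^ β))) * Real.exp (-(c₁ / 2 * t ^ β)) := by
        rw [Real.exp_add]; ring
    _ ≤ _ := by gcongr

theorem exists_gevrey_factor_of_bounds {V 𝒜 ι : Type} [NormedAddCommGroup V]
    [InnerProductSpace ℝ V] [FiniteDimensional ℝ V] [MeasurableSpace V] [BorelSpace V]
    [Fintype 𝒜] [Fintype ι] [Nonempty ι]
    {P P' : V → ℂ → (𝒜 → ℝ) →L[ℝ] ℂ} {CP : ℝ} (hCP : 0 ≤ CP)
    (hPb : ∀ ξ z, ‖P ξ z‖ ≤ CP * (1 + ‖ξ‖ + ‖z‖) ^ Fintype.card ι)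
    (hPb' : ∀ ξ z, ‖P' ξ z‖ ≤ CP * (1 + ‖ξ‖ + ‖z‖) ^ Fintype.card ι)
    (hPc : ∀ b, Continuous fun q : V × ℂ => P q.1 q.2 b)
    (hPc' : ∀ b, Continuous fun q : V × ℂ => P' q.1 q.2 b)
    (hd : ∀ ξ z b, HasDerivAt (fun z => P ξ z b) (P' ξ z b) z)
    {β : V → 𝒜 → ℝ} {γ : ι → V → V}
    (hroot : ∀ x ξ z, P ξ z (β x) = ∏ g, (z - ((inner ℝ ξ (γ g x) : ℝ) : ℂ)))
    {h : V → ℂ} (hh : ContDiff ℝ (⊤ : ℕ∞) h) (hs : HasCompactSupport h) {δ C ρ : ℝ} (hδ : 0 < δ)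
    (hρ : 0 < ρ) (hb : ∀ k x, ‖iteratedFDeriv ℝ k h x‖ ≤ C * ρ ^ k * k ! * (k ! : ℝ) ^ δ)
    {B₀ : ℝ} (hB₀ : 0 ≤ B₀) :
    ∃ F : (𝒜 → ℝ) → ℂ, ContDiff ℝ (⊤ : ℕ∞) F ∧
      (∃ C' ρ' : ℝ, 0 < C' ∧ 0 < ρ' ∧ ∀ k r b, 0 ≤ r → ‖b‖ ≤ r → ‖iteratedFDeriv ℝ k F b‖ ≤
        C' * ((1 + r) * (ρ' ^ k * k ! * (k ! : ℝ) ^ (δ * Fintype.card ι)))) ∧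
      ∀ x, (∀ g, ‖γ g x‖ ≤ B₀) → F (β x) = (Fintype.card ι : ℂ)⁻¹ * ∑ g, h (γ g x) := by
  set m := Fintype.card ι with hm
  have hm0 : 0 < m := Fintype.card_pos
  have hm1 : (0 : ℝ) < m := by exact_mod_cast hm0
  set s : ℝ := δ * m with hsdef
  have hs0 : 0 < s := by positivity
  obtain ⟨N, hN, hNs⟩ : ∃ N : ℕ, Odd N ∧ (1 : ℝ) / N ≤ s := by
    obtain ⟨N, hN⟩ := exists_nat_gt (1 / s)
    refine ⟨2 * N + 1, ⟨N, rfl⟩, ?_⟩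
    rw [div_lt_iff₀ hs0] at hN
    rw [div_le_iff₀ (by positivity)]
    push_cast
    have : (0 : ℝ) ≤ N := by positivity
    nlinarith
  obtain ⟨CΨ, hCΨ, C₀, hC₀, ρΨ, hρΨ, HΨ⟩ := exists_regularized_inv hN
  obtain ⟨Cf, hCf, c₁, hc₁, hfb⟩ := exists_norm_fourier_le_exp hh hs hδ hρ hb
  set e : ℝ := (1 + δ)⁻¹ with he
  have he0 : 0 < e := by positivity
  have he1 : e ≤ 1 := inv_le_one_of_one_le₀ (by linarith)
  obtain ⟨c, hc, hc2, a, ha, C₂, hC₂, habs⟩ := exists_absorbing_constants hc₁ he0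
    (D := C₀ + s) (by positivity) (m + 1)
  choose Ψ hΨc hΨi hΨb using fun j : ℕ => HΨ (a * ((j : ℝ) + 1)) (by positivity)
  let T : V → ℝ := fun ξ => 1 + ‖ξ‖
  let J : V → ℕ := fun ξ => ⌊T ξ ^ e⌋₊
  let ν : V → ℝ := fun ξ => (J ξ : ℝ) + 1
  let X : V → ℝ := fun ξ => (B₀ + 1) * T ξ
  let Y : V → ℝ := fun ξ => c * ν ξ
  let ε : V → ℝ := fun ξ => Y ξ ^ m
  let φ₀ : V → ℂ := fun ξ => FourierTransform.fourier h ξ * (2 * Real.pi * Complex.I * m)⁻¹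
  have hT1 : ∀ ξ, 1 ≤ T ξ := fun ξ => by simp [T]
  have hTe : ∀ ξ, 1 ≤ T ξ ^ e := fun ξ => Real.one_le_rpow (hT1 ξ) he0.le
  have hν0 : ∀ ξ, 0 < ν ξ := fun ξ => by positivity
  have hνl : ∀ ξ, T ξ ^ e ≤ ν ξ := fun ξ => (Nat.lt_floor_add_one _).le
  have hνu : ∀ ξ, ν ξ ≤ 2 * T ξ ^ e := fun ξ => by
    have := Nat.floor_le (zero_le_one.trans (hTe ξ))
    have := hTe ξ
    simp only [ν, J]; linarith
  have hν1 : ∀ ξ, 1 ≤ ν ξ := fun ξ => (hTe ξ).trans (hνl ξ)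
  have hY0 : ∀ ξ, 0 < Y ξ := fun ξ => mul_pos hc (hν0 ξ)
  have hYT : ∀ ξ, Y ξ ≤ T ξ := fun ξ => by
    have h1 : T ξ ^ e ≤ T ξ := by
      simpa using Real.rpow_le_rpow_of_exponent_le (hT1 ξ) he1
    calc c * ν ξ ≤ 1 / 2 * (2 * T ξ ^ e) := by
          gcongr; exact hνu ξ
      _ ≤ _ := by linarith
  have hX0 : ∀ ξ, 0 ≤ X ξ := fun ξ => mul_nonneg (by linarith) (zero_le_one.trans (hT1 ξ))
  have hε0 : ∀ ξ, 0 < ε ξ := fun ξ => pow_pos (hY0 ξ) _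
  have hTm : Measurable T := by fun_prop
  have hJm : Measurable J := Nat.measurable_floor.comp (hTm.pow_const e)
  have hνm : Measurable ν := (measurable_from_nat (f := fun j : ℕ => (j : ℝ) + 1)).comp hJm
  have hXm : Measurable X := hTm.const_mul _
  have hYm : Measurable Y := hνm.const_mul _
  have hεm : Measurable ε := hYm.pow_const m
  have h_int : MeasureTheory.Integrable h := hh.continuous.integrable_of_hasCompactSupport hs
  have hFc : Continuous (FourierTransform.fourier h) :=
    VectorFourier.fourierIntegral_continuous Real.continuous_fourierChar
      continuous_inner h_int
  have hFi : MeasureTheory.Integrable (FourierTransform.fourier h) :=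
    ((integrable_exp_neg_one_add_norm_rpow hc₁ he0).const_mul Cf).mono'
      hFc.aestronglyMeasurable (Filter.Eventually.of_forall hfb)
  have hηm : Measurable φ₀ := hFc.measurable.mul_const _
  let Λ : ℝ := CP * (B₀ + 3) ^ m * (c⁻¹) ^ m
  have hΛ : 0 ≤ Λ := by positivity
  let R : ℝ := 2 * max 1 (ρΨ * Λ * a ^ (-s))
  have hR : 0 < R := by positivity
  let K : Fin 4 → V × ℝ → (𝒜 → ℝ) → ℂ := fun i q b => rectKernel Ψ P P' φ₀ X Y ε J i q b
  let D : ℝ := (Cf * ‖(2 * Real.pi * Complex.I * m : ℂ)⁻¹‖) * (B₀ + 2) * (c⁻¹) ^ m *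
    (CΨ * (CP * (B₀ + 3) ^ m)) * C₂
  let μ : MeasureTheory.Measure (V × ℝ) := (MeasureTheory.volume : MeasureTheory.Measure V).prod
    ((MeasureTheory.volume : MeasureTheory.Measure ℝ).restrict (Set.Ioc (-1) 1))
  let Bd : V × ℝ → ℝ := fun q => D * Real.exp (-(c₁ / 2 * T q.1 ^ e))
  have hBd : MeasureTheory.Integrable Bd μ :=
    (MeasureTheory.Integrable.comp_fst
      (integrable_exp_neg_one_add_norm_rpow (half_pos hc₁) he0) _).const_mul D
  have hPbd : ∀ (L : V → ℂ → (𝒜 → ℝ) →L[ℝ] ℂ)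
      (_ : ∀ ξ z, ‖L ξ z‖ ≤ CP * (1 + ‖ξ‖ + ‖z‖) ^ m) ξ (i : Fin 4) τ,
      ‖L ξ (rectSide (X ξ) (Y ξ) i (max (-1) (min 1 τ)))‖ ≤ CP * (B₀ + 3) ^ m * T ξ ^ m := by
    intro L hL ξ i τ
    have h1 := norm_rectSide_le (hX0 ξ) (hY0 ξ).le i (abs_max_min_le_one τ)
    refine (hL ξ _).trans ?_
    rw [mul_assoc, ← mul_pow]
    gcongr
    have h2 := hYT ξ
    simp only [T, X] at *
    linarith
  have hTν : ∀ ξ, T ξ ^ m ≤ ν ξ ^ m * ν ξ ^ s := by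
    intro ξ
    have h1 : T ξ ≤ ν ξ ^ (1 + δ) := by
      have : (T ξ ^ e) ^ (1 + δ) = T ξ := by
        rw [← Real.rpow_mul (zero_le_one.trans (hT1 ξ)), he, inv_mul_cancel₀ (by linarith),
          Real.rpow_one]
      rw [← this]
      exact Real.rpow_le_rpow (by linarith [hTe ξ]) (hνl ξ) (by linarith)
    calc T ξ ^ m ≤ (ν ξ ^ (1 + δ)) ^ m := pow_le_pow_left₀ (by linarith [hT1 ξ]) h1 m
      _ = _ := by
        rw [← Real.rpow_natCast, ← Real.rpow_natCast, ← Real.rpow_mul (hν0 ξ).le,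
          ← Real.rpow_add (hν0 ξ), hsdef]
        ring_nf
  have hεP : ∀ ξ (i : Fin 4) τ,
      ‖(ε ξ)⁻¹ • P ξ (rectSide (X ξ) (Y ξ) i (max (-1) (min 1 τ)))‖ ≤ Λ * ν ξ ^ s := by
    intro ξ i τ
    rw [norm_smul, norm_inv, Real.norm_of_nonneg (hε0 ξ).le]
    calc _ ≤ (ε ξ)⁻¹ * (CP * (B₀ + 3) ^ m * (ν ξ ^ m * ν ξ ^ s)) := by
          have := hε0 ξ
          gcongr
          exact (hPbd P hPb ξ i τ).trans (by gcongr; exact hTν ξ)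
      _ = _ := by
          have := pow_ne_zero m (hν0 ξ).ne'
          have := pow_ne_zero m hc.ne'
          simp only [ε, Y, Λ, mul_pow, inv_pow]
          field_simp
  have hKs : ∀ i q, ContDiff ℝ (⊤ : ℕ∞) (K i q) := by
    intro i q
    have h1 := ((ε q.1)⁻¹ •
      P q.1 (rectSide (X q.1) (Y q.1) i (max (-1) (min 1 q.2)))).contDiff (n := (⊤ : ℕ∞))
    have h2 := (P' q.1 (rectSide (X q.1) (Y q.1) i (max (-1) (min 1 q.2)))).contDiff
      (n := (⊤ : ℕ∞))
    exact contDiff_const.mul (((hΨc (J q.1)).comp h1).mul h2)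
  have hκb : ∀ (i : Fin 4) ξ (z : ℂ), -Y ξ ≤ z.im → ‖φ₀ ξ * rectWeight (X ξ) (Y ξ) i *
      Complex.exp (2 * Real.pi * Complex.I * z) * ((ε ξ)⁻¹ : ℝ)‖ ≤
      Cf * Real.exp (-(c₁ * T ξ ^ e)) * ‖(2 * Real.pi * Complex.I * m : ℂ)⁻¹‖ *
        ((B₀ + 2) * T ξ) * Real.exp (2 * Real.pi * (c * ν ξ)) * (c⁻¹) ^ m := by
    intro i ξ z hz
    have h1 : ‖rectWeight (X ξ) (Y ξ) i‖ ≤ (B₀ + 2) * T ξ := by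
      refine (norm_rectWeight_le (hX0 ξ) (hY0 ξ).le i).trans ?_
      have := hYT ξ
      simp only [X]; linarith
    have h2 : ‖Complex.exp (2 * Real.pi * Complex.I * z)‖ ≤ Real.exp (2 * Real.pi * (c * ν ξ)) := by
      rw [Complex.norm_exp]
      apply Real.exp_le_exp.2
      have hpi := Real.pi_pos
      have : (2 * Real.pi * Complex.I * z).re = 2 * Real.pi * (-z.im) := by
        simp [Complex.mul_re, Complex.mul_im]
      rw [this]
      exact mul_le_mul_of_nonneg_left (by simp only [Y] at hz; linarith) (by positivity)
    have h3 : ‖(((ε ξ)⁻¹ : ℝ) : ℂ)‖ ≤ (c⁻¹) ^ m := by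
      rw [Complex.norm_real, norm_inv, Real.norm_of_nonneg (hε0 ξ).le, inv_pow]
      apply inv_anti₀ (by positivity)
      exact pow_le_pow_left₀ hc.le (le_mul_of_one_le_right hc.le (hν1 ξ)) m
    rw [norm_mul, norm_mul, norm_mul, norm_mul]
    have := hT1 ξ
    gcongr
    exact hfb ξ
  have hKb : ∀ i q k r b, 0 ≤ r → ‖b‖ ≤ r → ‖iteratedFDeriv ℝ k (K i q) b‖ ≤
      Bd q * ((1 + r) * (R ^ k * k ! * (k ! : ℝ) ^ s)) := by
    intro i q k r b hr hbr
    refine (norm_iteratedFDeriv_kernel_le hNs ha (hν0 q.1) hCΨ.le hρΨ.le hr hΛ (hΨc (J q.1))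
      (hΨb (J q.1)) _ _ (hεP q.1 i q.2) _ k hbr).trans ?_
    have hν := hν0 q.1
    have hP1 := hPbd P' hPb' q.1 i q.2
    have hT := zero_le_one.trans (hT1 q.1)
    have hκ := hκb i q.1 (rectSide (X q.1) (Y q.1) i (max (-1) (min 1 q.2)))
      (neg_le_im_rectSide (hY0 q.1).le i (abs_max_min_le_one q.2))
    have ha1 := habs (T q.1) (hT1 q.1) (ν q.1) (hνu q.1)
    calc _ ≤ (Cf * Real.exp (-(c₁ * T q.1 ^ e)) * ‖(2 * Real.pi * Complex.I * m : ℂ)⁻¹‖ *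
            ((B₀ + 2) * T q.1) * Real.exp (2 * Real.pi * (c * ν q.1)) * (c⁻¹) ^ m) *
          (CΨ * Real.exp ((C₀ + s) * (a * ν q.1)) * ((CP * (B₀ + 3) ^ m * T q.1 ^ m) * (1 + r)) *
            R ^ k * k ! * (k ! : ℝ) ^ s) := by gcongr
      _ = (Cf * ‖(2 * Real.pi * Complex.I * m : ℂ)⁻¹‖) * (B₀ + 2) * (c⁻¹) ^ m *
          (CΨ * (CP * (B₀ + 3) ^ m)) * (T q.1 ^ (m + 1) * Real.exp (-(c₁ * T q.1 ^ e)) *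
            Real.exp (2 * Real.pi * (c * ν q.1)) * Real.exp ((C₀ + s) * (a * ν q.1))) *
          ((1 + r) * (R ^ k * k ! * (k ! : ℝ) ^ s)) := by ring
      _ ≤ (Cf * ‖(2 * Real.pi * Complex.I * m : ℂ)⁻¹‖) * (B₀ + 2) * (c⁻¹) ^ m *
          (CΨ * (CP * (B₀ + 3) ^ m)) * (C₂ * Real.exp (-(c₁ / 2 * T q.1 ^ e))) *
          ((1 + r) * (R ^ k * k ! * (k ! : ℝ) ^ s)) := by gcongr
      _ = _ := by simp only [Bd, D]; ring
  have hKm : ∀ i b, MeasureTheory.StronglyMeasurable fun q => K i q b := fun i b =>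
    stronglyMeasurable_rectKernel (fun j => (hΨc j).continuous) hPc hPc' hηm hXm hYm hεm hJm i b
  have hI := fun i => norm_iteratedFDeriv_integral_le (hKs i) (hKm i) hBd (hKb i)
  refine ⟨fun b => ∑ i, ∫ q, K i q b ∂μ, ContDiff.sum fun i _ => (hI i).1,
    ⟨4 * (∫ q, Bd q ∂μ) + 1, R, ?_, hR, fun k r b hr hbr => ?_⟩, fun x hx => ?_⟩
  · have : 0 ≤ ∫ q, Bd q ∂μ := MeasureTheory.integral_nonneg fun q => by positivity
    linarith
  · have h1 : iteratedFDeriv ℝ k (fun b => ∑ i, ∫ q, K i q b ∂μ) b =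
        ∑ i, iteratedFDeriv ℝ k (fun b => ∫ q, K i q b ∂μ) b :=
      iteratedFDeriv_fun_sum_apply
        fun i _ => ((hI i).1.of_le (by exact_mod_cast le_top)).contDiffAt
    rw [h1]
    refine (norm_sum_le _ _).trans ((Finset.sum_le_sum fun i _ => (hI i).2 k r b hr hbr).trans ?_)
    rw [Finset.sum_const, Finset.card_univ, Fintype.card_fin, nsmul_eq_mul, ← mul_assoc]
    apply mul_le_mul_of_nonneg_right _ (by positivity)
    push_cast
    linarith
  · have hKi : ∀ i, MeasureTheory.Integrable (fun q => K i q (β x)) μ := fun i => by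
      refine (hBd.mul_const ((1 + ‖β x‖) * (R ^ 0 * 0 ! * (0 ! : ℝ) ^ s))).mono'
        (hKm i (β x)).aestronglyMeasurable (Filter.Eventually.of_forall fun q => ?_)
      have := hKb i q 0 ‖β x‖ (β x) (norm_nonneg _) le_rfl
      rwa [norm_iteratedFDeriv_zero] at this
    have hE : ∀ g, MeasureTheory.Integrable (fun ξ => Complex.exp
        (((2 * Real.pi * inner ℝ ξ (γ g x) : ℝ) : ℂ) * Complex.I) •
          FourierTransform.fourier h ξ) := fun g => by
      refine hFi.norm.mono' (Continuous.aestronglyMeasurable (by fun_prop))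
        (Filter.Eventually.of_forall fun ξ => ?_)
      rw [norm_smul, Complex.norm_exp_ofReal_mul_I, one_mul]
    have hval : ∀ ξ, ∑ i, ∫ τ in Set.Ioc (-1 : ℝ) 1, K i (ξ, τ) (β x) =
        (m : ℂ)⁻¹ * ∑ g, Complex.exp (((2 * Real.pi * inner ℝ ξ (γ g x) : ℝ) : ℂ) * Complex.I) •
          FourierTransform.fourier h ξ := fun ξ => by
      have hXY : ∀ g, Y ξ ≤ X ξ - |(inner ℝ ξ (γ g x) : ℝ)| := fun g => by
        have h1 := (abs_real_inner_le_norm ξ (γ g x)).trans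
          (mul_le_mul_of_nonneg_left (hx g) (norm_nonneg ξ))
        have h2 := hYT ξ
        simp only [X, T] at *
        linarith
      refine (sum_integral_rectKernel hΨi hd (hroot x ξ) (hY0 ξ) rfl hXY).trans ?_
      have hmc : (m : ℂ) ≠ 0 := by exact_mod_cast hm0.ne'
      have hpi : (Real.pi : ℂ) ≠ 0 := by exact_mod_cast Real.pi_ne_zero
      simp only [φ₀, smul_eq_mul, ← Finset.sum_mul]
      have : ∀ g, Complex.exp (2 * Real.pi * Complex.I * (inner ℝ ξ (γ g x) : ℝ)) =
          Complex.exp (((2 * Real.pi * inner ℝ ξ (γ g x) : ℝ) : ℂ) * Complex.I) := fun g => by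
        push_cast; ring_nf
      simp only [this]
      field_simp [Complex.I_ne_zero]
    calc ∑ i, ∫ q, K i q (β x) ∂μ
        = ∑ i, ∫ ξ, ∫ τ in Set.Ioc (-1 : ℝ) 1, K i (ξ, τ) (β x) :=
          Finset.sum_congr rfl fun i _ => MeasureTheory.integral_prod _ (hKi i)
      _ = ∫ ξ, ∑ i, ∫ τ in Set.Ioc (-1 : ℝ) 1, K i (ξ, τ) (β x) :=
          (MeasureTheory.integral_finsetSum _ fun i _ => (hKi i).integral_prod_left).symm
      _ = ∫ ξ, (m : ℂ)⁻¹ * ∑ g, Complex.exp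
            (((2 * Real.pi * inner ℝ ξ (γ g x) : ℝ) : ℂ) * Complex.I) •
          FourierTransform.fourier h ξ := by simp only [hval]
      _ = (m : ℂ)⁻¹ * ∑ g, h (γ g x) := by
          rw [MeasureTheory.integral_const_mul, MeasureTheory.integral_finsetSum _ fun g _ => hE g]
          congr 1
          refine Finset.sum_congr rfl fun g _ => ?_
          rw [← Real.fourierInv_eq',
            MeasureTheory.Integrable.fourierInv_fourier_eq h_int hFi hh.continuous.continuousAt]

/-- The monomial of exponent `α` in the variables `z`, `ξ`. -/
noncomputable def pencilMonomial {n : ℕ} (α : Option (Fin n) →₀ ℕ) (ξ : EuclideanSpace ℝ (Fin n))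
    (z : ℂ) : ℂ :=
  z ^ α none * ∏ j, (ξ j : ℂ) ^ α (some j)

/-- The derivative of `pencilMonomial α ξ z` with respect to `z`. -/
noncomputable def pencilMonomialDeriv {n : ℕ} (α : Option (Fin n) →₀ ℕ)
    (ξ : EuclideanSpace ℝ (Fin n)) (z : ℂ) : ℂ :=
  (α none * z ^ (α none - 1)) * ∏ j, (ξ j : ℂ) ^ α (some j)

/-- The linear map `b ↦ ∑ α, c α * b α`. -/
noncomputable def linearCombinationCLM {𝒜 : Type*} [Fintype 𝒜] (c : 𝒜 → ℂ) : (𝒜 → ℝ) →L[ℝ] ℂ :=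
  ∑ α, c α • (Complex.ofRealCLM.comp (ContinuousLinearMap.proj α))

theorem linearCombinationCLM_apply {𝒜 : Type*} [Fintype 𝒜] (c : 𝒜 → ℂ) (b : 𝒜 → ℝ) :
    linearCombinationCLM c b = ∑ α, c α * b α := by
  simp [linearCombinationCLM, _root_.sum_apply]

theorem norm_linearCombinationCLM_le {𝒜 : Type*} [Fintype 𝒜] {c : 𝒜 → ℂ} {T : ℝ} (hT : 0 ≤ T)
    (hc : ∀ α, ‖c α‖ ≤ T) : ‖linearCombinationCLM c‖ ≤ Fintype.card 𝒜 * T := by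
  refine ContinuousLinearMap.opNorm_le_bound _ (by positivity) fun b => ?_
  rw [linearCombinationCLM_apply]
  refine (norm_sum_le _ _).trans ((Finset.sum_le_sum (g := fun _ => T * ‖b‖) fun α _ => ?_).trans ?_)
  · rw [norm_mul, Complex.norm_real]
    exact mul_le_mul (hc α) (norm_le_pi_norm b α) (norm_nonneg _) hT
  · rw [Finset.sum_const, Finset.card_univ, nsmul_eq_mul, mul_assoc]

theorem norm_pencil_prod_le {n : ℕ} (α : Option (Fin n) →₀ ℕ) (ξ : EuclideanSpace ℝ (Fin n))
    {T : ℝ} (hT : ‖ξ‖ ≤ T) :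
    ‖∏ j, (ξ j : ℂ) ^ α (some j)‖ ≤ T ^ ∑ j, α (some j) := by
  rw [norm_prod, ← Finset.prod_pow_eq_pow_sum]
  refine Finset.prod_le_prod (fun _ _ => norm_nonneg _) fun j _ => ?_
  rw [norm_pow, Complex.norm_real]
  exact pow_le_pow_left₀ (norm_nonneg _) ((PiLp.norm_apply_le ξ j).trans hT) _

theorem norm_pencilMonomial_le {n m : ℕ} {α : Option (Fin n) →₀ ℕ} (hα : α none + ∑ j, α (some j) ≤ m)
    (ξ : EuclideanSpace ℝ (Fin n)) (z : ℂ) :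
    ‖pencilMonomial α ξ z‖ ≤ (1 + ‖ξ‖ + ‖z‖) ^ m := by
  have hξ := norm_nonneg ξ
  have hz := norm_nonneg z
  rw [pencilMonomial, norm_mul, norm_pow]
  calc _ ≤ (1 + ‖ξ‖ + ‖z‖) ^ α none * (1 + ‖ξ‖ + ‖z‖) ^ ∑ j, α (some j) := by
        gcongr
        · linarith
        · exact norm_pencil_prod_le α ξ (by linarith)
    _ = (1 + ‖ξ‖ + ‖z‖) ^ (α none + ∑ j, α (some j)) := (pow_add _ _ _).symm
    _ ≤ _ := pow_le_pow_right₀ (by linarith) hα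

theorem norm_pencilMonomialDeriv_le {n m : ℕ} {α : Option (Fin n) →₀ ℕ}
    (hα : α none + ∑ j, α (some j) ≤ m) (ξ : EuclideanSpace ℝ (Fin n)) (z : ℂ) :
    ‖pencilMonomialDeriv α ξ z‖ ≤ m * (1 + ‖ξ‖ + ‖z‖) ^ m := by
  have hξ := norm_nonneg ξ
  have hz := norm_nonneg z
  rw [pencilMonomialDeriv, norm_mul, norm_mul, norm_pow, Complex.norm_natCast]
  calc _ ≤ (m * (1 + ‖ξ‖ + ‖z‖) ^ (α none - 1)) * (1 + ‖ξ‖ + ‖z‖) ^ ∑ j, α (some j) := by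
        gcongr
        · omega
        · linarith
        · exact norm_pencil_prod_le α ξ (by linarith)
    _ = m * (1 + ‖ξ‖ + ‖z‖) ^ (α none - 1 + ∑ j, α (some j)) := by rw [pow_add]; ring
    _ ≤ _ := by
        gcongr
        · linarith
        · omega

theorem hasDerivAt_pencilMonomial {n : ℕ} (α : Option (Fin n) →₀ ℕ) (ξ : EuclideanSpace ℝ (Fin n))
    (z : ℂ) : HasDerivAt (pencilMonomial α ξ) (pencilMonomialDeriv α ξ z) z :=
  (hasDerivAt_pow (α none) z).mul_const _

theorem continuous_pencilMonomial {n : ℕ} (α : Option (Fin n) →₀ ℕ) :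
    Continuous fun q : EuclideanSpace ℝ (Fin n) × ℂ => pencilMonomial α q.1 q.2 := by
  unfold pencilMonomial; fun_prop

theorem continuous_pencilMonomialDeriv {n : ℕ} (α : Option (Fin n) →₀ ℕ) :
    Continuous fun q : EuclideanSpace ℝ (Fin n) × ℂ => pencilMonomialDeriv α q.1 q.2 := by
  unfold pencilMonomialDeriv; fun_prop

/-- The `j`-th coordinate of `x ↦ A x` as a polynomial. -/
noncomputable def mulVecPolynomial {n : ℕ} (A : Matrix (Fin n) (Fin n) ℝ) (j : Fin n) :
    MvPolynomial (Fin n) ℝ :=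
  ∑ k, MvPolynomial.C (A j k) * MvPolynomial.X k

theorem eval_mulVecPolynomial {n : ℕ} (A : Matrix (Fin n) (Fin n) ℝ) (j : Fin n) (x : Fin n → ℝ) :
    MvPolynomial.eval x (mulVecPolynomial A j) = (A *ᵥ x) j := by
  simp [mulVecPolynomial, Matrix.mulVec, dotProduct]

/-- The product of the linear factors `z - ⟪ξ, g x⟫` over `g ∈ G`, as a polynomial in `z` and `ξ`
with coefficients that are polynomials in `x`. -/
noncomputable def orbitPolynomial {n : ℕ} (G : Subgroup (GL (Fin n) ℝ)) [Fintype G] :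
    MvPolynomial (Option (Fin n)) (MvPolynomial (Fin n) ℝ) :=
  ∏ g : G, (MvPolynomial.X none -
    ∑ j, MvPolynomial.C (mulVecPolynomial (g : GL (Fin n) ℝ).val j) * MvPolynomial.X (some j))

theorem map_eval_orbitPolynomial {n : ℕ} (G : Subgroup (GL (Fin n) ℝ)) [Fintype G]
    (x : Fin n → ℝ) :
    MvPolynomial.map (MvPolynomial.eval x) (orbitPolynomial G) =
      ∏ g : G, (MvPolynomial.X none -
        ∑ j, MvPolynomial.C (((g : GL (Fin n) ℝ).val *ᵥ x) j) * MvPolynomial.X (some j)) := by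
  simp [orbitPolynomial, map_prod, eval_mulVecPolynomial]

theorem eval_coeff_orbitPolynomial_invariant {n : ℕ} (G : Subgroup (GL (Fin n) ℝ)) [Fintype G]
    (α : Option (Fin n) →₀ ℕ) {h : GL (Fin n) ℝ} (hh : h ∈ G) (x : Fin n → ℝ) :
    MvPolynomial.eval (h.val *ᵥ x) (MvPolynomial.coeff α (orbitPolynomial G)) =
      MvPolynomial.eval x (MvPolynomial.coeff α (orbitPolynomial G)) := by
  rw [← MvPolynomial.coeff_map, ← MvPolynomial.coeff_map]
  congr 1
  rw [map_eval_orbitPolynomial, map_eval_orbitPolynomial]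
  refine Fintype.prod_equiv (Equiv.mulRight (⟨h, hh⟩ : G)) _ _ fun g => ?_
  simp [Matrix.mulVec_mulVec]

theorem totalDegree_orbitPolynomial_le {n : ℕ} (G : Subgroup (GL (Fin n) ℝ)) [Fintype G] :
    (orbitPolynomial G).totalDegree ≤ Fintype.card G := by
  refine (MvPolynomial.totalDegree_finsetProd _ _).trans ?_
  refine (Finset.sum_le_card_nsmul _ _ 1 fun g _ => ?_).trans (by simp)
  refine (MvPolynomial.totalDegree_sub _ _).trans (max_le (MvPolynomial.totalDegree_X _).le ?_)
  refine (MvPolynomial.totalDegree_finsetSum _ _).trans (Finset.sup_le fun j _ => ?_)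
  refine (MvPolynomial.totalDegree_mul _ _).trans ?_
  rw [MvPolynomial.totalDegree_C, zero_add]
  exact (MvPolynomial.totalDegree_X _).le

theorem sum_pencilMonomial_orbitPolynomial {n : ℕ} (G : Subgroup (GL (Fin n) ℝ)) [Fintype G]
    (x ξ : EuclideanSpace ℝ (Fin n)) (z : ℂ) :
    ∑ α : (orbitPolynomial G).support, pencilMonomial α.1 ξ z *
        (MvPolynomial.eval x.ofLp (MvPolynomial.coeff α.1 (orbitPolynomial G)) : ℝ) =
      ∏ g : G, (z - ((inner ℝ ξ (WithLp.toLp 2 ((g : GL (Fin n) ℝ).val *ᵥ x.ofLp)) : ℝ) : ℂ)) := by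
  let v : Option (Fin n) → ℂ := fun o => o.elim z fun j => (ξ j : ℂ)
  let φ₁ : MvPolynomial (Fin n) ℝ →+* ℂ := Complex.ofRealHom.comp (MvPolynomial.eval x.ofLp)
  have h1 : MvPolynomial.eval₂ φ₁ v (orbitPolynomial G) =
      ∑ α : (orbitPolynomial G).support, pencilMonomial α.1 ξ z *
        (MvPolynomial.eval x.ofLp (MvPolynomial.coeff α.1 (orbitPolynomial G)) : ℝ) := by
    rw [MvPolynomial.eval₂_eq', ← Finset.sum_coe_sort]
    refine Finset.sum_congr rfl fun α _ => ?_
    rw [Fintype.prod_option, mul_comm]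
    rfl
  rw [← h1, ← MvPolynomial.coe_eval₂Hom, orbitPolynomial, map_prod]
  refine Finset.prod_congr rfl fun g _ => ?_
  simp [v, φ₁, eval_mulVecPolynomial, PiLp.inner_apply]

theorem exists_gevrey_factor_orbitPolynomial {n : ℕ} (G : Subgroup (GL (Fin n) ℝ)) [Fintype G]
    {h : EuclideanSpace ℝ (Fin n) → ℂ} (hh : ContDiff ℝ (⊤ : ℕ∞) h) (hs : HasCompactSupport h)
    {δ C ρ : ℝ} (hδ : 0 < δ) (hρ : 0 < ρ)
    (hb : ∀ k x, ‖iteratedFDeriv ℝ k h x‖ ≤ C * ρ ^ k * k ! * (k ! : ℝ) ^ δ)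
    {B₀ : ℝ} (hB₀ : 0 ≤ B₀) :
    ∃ F : ((orbitPolynomial G).support → ℝ) → ℂ, ContDiff ℝ (⊤ : ℕ∞) F ∧
      (∃ C' ρ' : ℝ, 0 < C' ∧ 0 < ρ' ∧ ∀ k r b, 0 ≤ r → ‖b‖ ≤ r → ‖iteratedFDeriv ℝ k F b‖ ≤
        C' * ((1 + r) * (ρ' ^ k * k ! * (k ! : ℝ) ^ (δ * Fintype.card G)))) ∧
      ∀ x : EuclideanSpace ℝ (Fin n),
        (∀ g : G, ‖WithLp.toLp 2 ((g : GL (Fin n) ℝ).val *ᵥ x.ofLp)‖ ≤ B₀) →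
        F (fun α => MvPolynomial.eval x.ofLp (MvPolynomial.coeff α.1 (orbitPolynomial G))) =
          (Fintype.card G : ℂ)⁻¹ *
            ∑ g : G, h (WithLp.toLp 2 ((g : GL (Fin n) ℝ).val *ᵥ x.ofLp)) := by
  set m := Fintype.card G
  have hdeg : ∀ α : (orbitPolynomial G).support, α.1 none + ∑ j, α.1 (some j) ≤ m := fun α => by
    have h1 := (MvPolynomial.le_totalDegree α.2).trans (totalDegree_orbitPolynomial_le G)
    rwa [Finsupp.sum_fintype _ _ (fun _ => rfl), Fintype.sum_option] at h1
  have hT : ∀ (ξ : EuclideanSpace ℝ (Fin n)) (z : ℂ), 0 ≤ (1 + ‖ξ‖ + ‖z‖) ^ m := fun ξ z => by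
    positivity
  refine exists_gevrey_factor_of_bounds (𝒜 := (orbitPolynomial G).support) (ι := G)
    (P := fun ξ z => linearCombinationCLM fun α : (orbitPolynomial G).support =>
      pencilMonomial α.1 ξ z)
    (P' := fun ξ z => linearCombinationCLM fun α : (orbitPolynomial G).support =>
      pencilMonomialDeriv α.1 ξ z)
    (CP := Fintype.card (orbitPolynomial G).support * (1 + m))
    (β := fun x α => MvPolynomial.eval x.ofLp (MvPolynomial.coeff α.1 (orbitPolynomial G)))
    (γ := fun g x => WithLp.toLp 2 ((g : GL (Fin n) ℝ).val *ᵥ x.ofLp))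
    (by positivity) (fun ξ z => ?_) (fun ξ z => ?_) (fun b => ?_) (fun b => ?_) (fun ξ z b => ?_)
    (fun x ξ z => ?_) hh hs hδ hρ hb hB₀
  · rw [mul_assoc]
    refine norm_linearCombinationCLM_le (by positivity) fun α => ?_
    have hm : (0 : ℝ) ≤ m := by positivity
    have := norm_pencilMonomial_le (hdeg α) ξ z
    nlinarith [hT ξ z]
  · rw [mul_assoc]
    refine norm_linearCombinationCLM_le (by positivity) fun α => ?_
    have := norm_pencilMonomialDeriv_le (hdeg α) ξ z
    nlinarith [hT ξ z]
  · simp only [linearCombinationCLM_apply]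
    exact continuous_finsetSum _ fun α _ => (continuous_pencilMonomial α.1).mul continuous_const
  · simp only [linearCombinationCLM_apply]
    exact continuous_finsetSum _ fun α _ =>
      (continuous_pencilMonomialDeriv α.1).mul continuous_const
  · simp only [linearCombinationCLM_apply]
    exact HasDerivAt.fun_sum fun α _ => (hasDerivAt_pencilMonomial α.1 ξ z).mul_const _
  · simp only [linearCombinationCLM_apply]
    exact sum_pencilMonomial_orbitPolynomial G x ξ z

/-- `f` is smooth and satisfies Gevrey estimates of order `1 + s` on every ball. -/
def IsGevrey {E F : Type*} [NormedAddCommGroup E] [NormedSpace ℝ E]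
    [NormedAddCommGroup F] [NormedSpace ℝ F] (s : ℝ) (f : E → F) : Prop :=
  ContDiff ℝ (⊤ : ℕ∞) f ∧ ∀ r : ℝ, ∃ C > (0 : ℝ), ∃ ρ > (0 : ℝ), ∀ (k : ℕ) (x : E), ‖x‖ ≤ r →
    ‖iteratedFDeriv ℝ k f x‖ ≤ C * ρ ^ k * k ! * (k ! : ℝ) ^ s

namespace IsGevrey

theorem iff_CMClassOn {E F : Type*} [NormedAddCommGroup E] [NormedSpace ℝ E] [ProperSpace E]
    [NormedAddCommGroup F] [NormedSpace ℝ F] {s : ℝ} {f : E → F} :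
    IsGevrey s f ↔ CMClassOn (fun k => (k ! : ℝ) ^ s) Set.univ f := by
  constructor
  · rintro ⟨h1, h2⟩
    refine ⟨h1.contDiffOn, fun K _ hK => ?_⟩
    obtain ⟨r, hr⟩ := hK.isBounded.exists_norm_le
    obtain ⟨C, hC, ρ, hρ, h⟩ := h2 r
    refine ⟨C, hC, ρ, hρ, fun k x hx => ?_⟩
    rw [iteratedFDerivWithin_univ]
    exact h k x (hr x hx)
  · rintro ⟨h1, h2⟩
    refine ⟨contDiffOn_univ.1 h1, fun r => ?_⟩
    obtain ⟨C, hC, ρ, hρ, h⟩ := h2 (Metric.closedBall 0 r) (Set.subset_univ _)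
      (isCompact_closedBall 0 r)
    refine ⟨C, hC, ρ, hρ, fun k x hx => ?_⟩
    have := h k x (by simpa using hx)
    rwa [iteratedFDerivWithin_univ] at this

section

variable {E F : Type*} [NormedAddCommGroup E] [NormedSpace ℝ E]
    [NormedAddCommGroup F] [NormedSpace ℝ F]

theorem mono {s t : ℝ} (hst : s ≤ t) {f : E → F} (hf : IsGevrey s f) : IsGevrey t f := by
  refine ⟨hf.1, fun r => ?_⟩
  obtain ⟨C, hC, ρ, hρ, h⟩ := hf.2 r
  refine ⟨C, hC, ρ, hρ, fun k x hx => (h k x hx).trans ?_⟩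
  gcongr
  exact_mod_cast Nat.factorial_pos k

theorem const {s : ℝ} (c : F) : IsGevrey s (fun _ : E => c) := by
  refine ⟨contDiff_const, fun r => ⟨‖c‖ + 1, by positivity, 1, one_pos, fun k x _ => ?_⟩⟩
  rcases k with _ | k
  · simp
  · rw [iteratedFDeriv_const_of_ne (by simp)]
    simp only [Pi.zero_apply, norm_zero]
    positivity

theorem add {s : ℝ} {f g : E → F} (hf : IsGevrey s f) (hg : IsGevrey s g) :
    IsGevrey s (fun x => f x + g x) := by
  refine ⟨hf.1.add hg.1, fun r => ?_⟩
  obtain ⟨C, hC, ρ, hρ, h⟩ := hf.2 r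
  obtain ⟨C', hC', ρ', hρ', h'⟩ := hg.2 r
  refine ⟨C + C', by positivity, max ρ ρ', by positivity, fun k x hx => ?_⟩
  have e : iteratedFDeriv ℝ k (fun x => f x + g x) x =
      iteratedFDeriv ℝ k f x + iteratedFDeriv ℝ k g x :=
    iteratedFDeriv_add_apply ((hf.1.of_le (by exact_mod_cast le_top)).contDiffAt)
      ((hg.1.of_le (by exact_mod_cast le_top)).contDiffAt)
  rw [e]
  calc _ ≤ C * ρ ^ k * k ! * (k ! : ℝ) ^ s + C' * ρ' ^ k * k ! * (k ! : ℝ) ^ s :=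
        (norm_add_le _ _).trans (add_le_add (h k x hx) (h' k x hx))
    _ ≤ C * max ρ ρ' ^ k * k ! * (k ! : ℝ) ^ s + C' * max ρ ρ' ^ k * k ! * (k ! : ℝ) ^ s := by
        gcongr
        · exact le_max_left _ _
        · exact le_max_right _ _
    _ = _ := by ring

theorem sum {ι : Type*} {s : ℝ} (S : Finset ι) {f : ι → E → F}
    (hf : ∀ i ∈ S, IsGevrey s (f i)) : IsGevrey s (fun x => ∑ i ∈ S, f i x) := by
  classical
  induction S using Finset.induction_on with
  | empty => simpa using const (0 : F)
  | insert i S hi ih =>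
    simp only [Finset.sum_insert hi]
    exact (hf i (Finset.mem_insert_self _ _)).add
      (ih fun j hj => hf j (Finset.mem_insert_of_mem hj))

theorem mul {s : ℝ} (hs : 0 ≤ s) {f g : E → ℝ} (hf : IsGevrey s f) (hg : IsGevrey s g) :
    IsGevrey s (fun x => f x * g x) := by
  refine ⟨hf.1.mul hg.1, fun r => ?_⟩
  obtain ⟨C, hC, ρ, hρ, h⟩ := hf.2 r
  obtain ⟨C', hC', ρ', hρ', h'⟩ := hg.2 r
  refine ⟨C * C', by positivity, 2 * max ρ ρ', by positivity, fun k x hx => ?_⟩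
  refine norm_iteratedFDeriv_mul_le_of_weights isOpen_univ hf.1.contDiffOn hg.1.contDiffOn
    (Set.mem_univ x) (M := fun k => (k ! : ℝ) ^ s) (M' := fun k => (k ! : ℝ) ^ s)
    (M'' := fun k => (k ! : ℝ) ^ s)
    (by positivity) hC.le hC'.le (fun k => by positivity) (factorial_rpow_mul_le hs)
    (fun k => (h k x hx).trans ?_) (fun k => (h' k x hx).trans ?_) k
  · gcongr; exact le_max_left _ _
  · gcongr; exact le_max_right _ _

theorem clm_comp {G : Type*} [NormedAddCommGroup G] [NormedSpace ℝ G] {s : ℝ} (L : F →L[ℝ] G)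
    {f : E → F} (hf : IsGevrey s f) : IsGevrey s (fun x => L (f x)) := by
  refine ⟨L.contDiff.comp hf.1, fun r => ?_⟩
  obtain ⟨C, hC, ρ, hρ, h⟩ := hf.2 r
  refine ⟨(‖L‖ + 1) * C, by positivity, ρ, hρ, fun k x hx => ?_⟩
  refine (L.norm_iteratedFDeriv_comp_left hf.1.contDiffAt
    (by exact_mod_cast le_top : (k : WithTop ℕ∞) ≤ (⊤ : ℕ∞))).trans ?_
  calc _ ≤ (‖L‖ + 1) * (C * ρ ^ k * k ! * (k ! : ℝ) ^ s) := by
        gcongr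
        · linarith
        · exact h k x hx
    _ = _ := by ring

theorem clm {s : ℝ} (hs : 0 ≤ s) (L : E →L[ℝ] F) : IsGevrey s (fun x => L x) := by
  refine ⟨L.contDiff, fun r => ⟨‖L‖ * (1 + |r|) + 1, by positivity, 1, one_pos, fun k x hx => ?_⟩⟩
  refine (norm_iteratedFDeriv_clm_le L (abs_nonneg r) (hx.trans (le_abs_self r)) k).trans ?_
  have e2 : (1 : ℝ) ≤ k ! := by exact_mod_cast Nat.factorial_pos k
  rw [one_pow, mul_one, mul_assoc]
  refine le_trans (by linarith : _ ≤ ‖L‖ * (1 + |r|) + 1) ?_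
  exact le_mul_of_one_le_right (by positivity)
    (one_le_mul_of_one_le_of_one_le e2 (one_le_factorial_rpow hs k))

theorem of_locally_eq {s : ℝ} {f : E → F}
    (h : ∀ r : ℝ, ∃ g : E → F, IsGevrey s g ∧ ∀ x, ‖x‖ < r → f x = g x) : IsGevrey s f := by
  have hev : ∀ {r : ℝ} {g : E → F}, (∀ x, ‖x‖ < r → f x = g x) → ∀ x, ‖x‖ < r →
      f =ᶠ[nhds x] g := fun {r g} hg x hx =>
    Filter.mem_of_superset ((isOpen_lt continuous_norm continuous_const).mem_nhds hx) fun y hy =>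
      hg y hy
  refine ⟨contDiff_iff_contDiffAt.2 fun x => ?_, fun r => ?_⟩
  · obtain ⟨g, hg, hfg⟩ := h (‖x‖ + 1)
    exact hg.1.contDiffAt.congr_of_eventuallyEq (hev hfg x (by linarith))
  · obtain ⟨g, hg, hfg⟩ := h (r + 1)
    obtain ⟨C, hC, ρ, hρ, hb⟩ := hg.2 r
    refine ⟨C, hC, ρ, hρ, fun k x hx => ?_⟩
    rw [((hev hfg x (by linarith)).iteratedFDeriv ℝ k).eq_of_nhds]
    exact hb k x hx

theorem exists_bound_of_hasCompactSupport {s : ℝ} {f : E → F} (hf : IsGevrey s f)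
    (hc : HasCompactSupport f) : ∃ C > (0 : ℝ), ∃ ρ > (0 : ℝ), ∀ (k : ℕ) (x : E),
      ‖iteratedFDeriv ℝ k f x‖ ≤ C * ρ ^ k * k ! * (k ! : ℝ) ^ s := by
  obtain ⟨r, hr⟩ := hc.isBounded.exists_norm_le
  obtain ⟨C, hC, ρ, hρ, h⟩ := hf.2 r
  refine ⟨C, hC, ρ, hρ, fun k x => ?_⟩
  by_cases hx : x ∈ tsupport f
  · exact h k x (hr x hx)
  · have : iteratedFDeriv ℝ k f x = 0 := by
      by_contra hne
      exact hx (support_iteratedFDeriv_subset k hne)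
    rw [this, norm_zero]
    positivity

end

theorem comp.{u} {E : Type*} {E' F : Type u} [NormedAddCommGroup E] [NormedSpace ℝ E]
    [NormedAddCommGroup E'] [NormedSpace ℝ E'] [NormedAddCommGroup F] [NormedSpace ℝ F] {s : ℝ}
    (hs : 0 ≤ s) {h : E' → F} (hh : IsGevrey s h) {B : E → E'} (hB : IsGevrey 0 B) :
    IsGevrey s (fun x => h (B x)) := by
  refine ⟨hh.1.comp hB.1, fun r => ?_⟩
  obtain ⟨b, hb, σ, hσ, hBb⟩ := hB.2 r
  obtain ⟨C, hC, ρ, hρ, hhb⟩ := hh.2 b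
  refine ⟨C, hC, 4 * σ + 2 * ρ * b * σ, by positivity, fun k x hx => ?_⟩
  have hB' : ∀ k, ‖iteratedFDeriv ℝ k B x‖ ≤ b * σ ^ k * k ! := fun k => by
    simpa using hBb k x hx
  have hBx : ‖B x‖ ≤ b := by simpa using hB' 0
  refine norm_iteratedFDeriv_comp_le_of_weights hB.1 hb.le hσ hB' hC.le hρ.le
    (M := fun k => (k ! : ℝ) ^ s) (fun k => by positivity) (fun i j hij => ?_) hh.1
    (fun i => hhb i _ hBx) k
  exact Real.rpow_le_rpow (by positivity) (by exact_mod_cast Nat.factorial_le hij) hs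

theorem pi {E ι : Type*} [NormedAddCommGroup E] [NormedSpace ℝ E] [Fintype ι] {s : ℝ}
    {f : ι → E → ℝ} (hf : ∀ i, IsGevrey s (f i)) :
    IsGevrey s (fun x i => f i x) := by
  classical
  have : (fun x i => f i x) = fun x => ∑ i,
      (ContinuousLinearMap.single ℝ (fun _ : ι => ℝ) i) (f i x) := by
    funext x j
    simp [Finset.sum_apply, Pi.single_apply]
  rw [this]
  exact sum _ fun i _ => (hf i).clm_comp _

theorem eval_mvPolynomial {ι : Type*} [Fintype ι] (P : MvPolynomial ι ℝ) :
    IsGevrey 0 (fun x : ι → ℝ => MvPolynomial.eval x P) := by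
  induction P using MvPolynomial.induction_on with
  | C a => simpa using const a
  | add p q hp hq => simpa using hp.add hq
  | mul_X p i hp =>
    simpa using hp.mul le_rfl (clm le_rfl (ContinuousLinearMap.proj i : (ι → ℝ) →L[ℝ] ℝ))

end IsGevrey

theorem exists_isGevrey_step {s : ℝ} (hs : 0 < s) : ∃ θ : ℝ → ℝ, IsGevrey s θ ∧
    (∀ v ≤ 0, θ v = 0) ∧ ∀ v ≥ 1, θ v = 1 := by
  obtain ⟨N, hN⟩ := exists_nat_gt (1 / s)
  have hN0 : (0 : ℝ) ≤ N := by positivity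
  rw [div_lt_iff₀ hs] at hN
  obtain ⟨C, hC, C₀, hC₀, ρ, hρ, H⟩ := exists_gevrey_step (N := 2 * N + 1) ⟨N, rfl⟩
  obtain ⟨θ, h1, h2, h3, h4⟩ := H 1 one_pos
  refine ⟨θ, IsGevrey.mono (s := (1 : ℝ) / (2 * N + 1 : ℕ)) ?_ ⟨h1, fun r => ⟨C * Real.exp (C₀ * 1),
    by positivity, ρ, by linarith, fun k x _ => ?_⟩⟩, h2, h3⟩
  · rw [div_le_iff₀ (by positivity)]
    push_cast
    nlinarith
  · simpa [scaledWeight] using h4 k x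

/-- The sum of the squared Euclidean norms of the points of the orbit of `x`, as a polynomial. -/
noncomputable def orbitNormSq {n : ℕ} (G : Subgroup (GL (Fin n) ℝ)) [Fintype G] :
    MvPolynomial (Fin n) ℝ :=
  ∑ g : G, ∑ j, mulVecPolynomial (g : GL (Fin n) ℝ).val j ^ 2

theorem eval_orbitNormSq {n : ℕ} (G : Subgroup (GL (Fin n) ℝ)) [Fintype G] (x : Fin n → ℝ) :
    MvPolynomial.eval x (orbitNormSq G) =
      ∑ g : G, ‖WithLp.toLp 2 ((g : GL (Fin n) ℝ).val *ᵥ x)‖ ^ 2 := by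
  simp [orbitNormSq, eval_mulVecPolynomial, EuclideanSpace.norm_sq_eq]

theorem eval_orbitNormSq_invariant {n : ℕ} (G : Subgroup (GL (Fin n) ℝ)) [Fintype G]
    {h : GL (Fin n) ℝ} (hh : h ∈ G) (x : Fin n → ℝ) :
    MvPolynomial.eval (h.val *ᵥ x) (orbitNormSq G) = MvPolynomial.eval x (orbitNormSq G) := by
  rw [eval_orbitNormSq, eval_orbitNormSq]
  refine Fintype.sum_equiv (Equiv.mulRight (⟨h, hh⟩ : G)) _ _ fun g => ?_
  simp [Matrix.mulVec_mulVec]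

theorem norm_sq_le_eval_orbitNormSq {n : ℕ} (G : Subgroup (GL (Fin n) ℝ)) [Fintype G] (g : G)
    (x : Fin n → ℝ) :
    ‖WithLp.toLp 2 ((g : GL (Fin n) ℝ).val *ᵥ x)‖ ^ 2 ≤ MvPolynomial.eval x (orbitNormSq G) := by
  rw [eval_orbitNormSq]
  exact Finset.single_le_sum (f := fun g : G => ‖WithLp.toLp 2 ((g : GL (Fin n) ℝ).val *ᵥ x)‖ ^ 2)
    (fun _ _ => sq_nonneg _) (Finset.mem_univ g)

theorem norm_toLp_sq_le_eval_orbitNormSq {n : ℕ} (G : Subgroup (GL (Fin n) ℝ)) [Fintype G]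
    (x : Fin n → ℝ) :
    ‖WithLp.toLp 2 x‖ ^ 2 ≤ MvPolynomial.eval x (orbitNormSq G) := by
  simpa using norm_sq_le_eval_orbitNormSq G 1 x

/-- A Gevrey invariant function agrees with a Gevrey function of the coefficients of the orbit
polynomial on each sublevel set of the orbit norm. -/
theorem exists_isGevrey_coeff_orbitPolynomial {n : ℕ} (G : Subgroup (GL (Fin n) ℝ)) [Fintype G]
    {δ : ℝ} (hδ : 0 < δ) {f : (Fin n → ℝ) → ℝ} (hf : IsGevrey δ f)
    (hfinv : ∀ g ∈ G, ∀ x : Fin n → ℝ, f (g.val *ᵥ x) = f x) {J : ℝ} (hJ : 0 ≤ J) :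
    ∃ H : ((orbitPolynomial G).support → ℝ) → ℝ, IsGevrey (δ * Fintype.card G) H ∧
      ∀ x : Fin n → ℝ, MvPolynomial.eval x (orbitNormSq G) ≤ J →
        H (fun α => MvPolynomial.eval x (MvPolynomial.coeff α.1 (orbitPolynomial G))) = f x := by
  obtain ⟨θ, hθ, hθ0, hθ1⟩ := exists_isGevrey_step hδ
  set u : (Fin n → ℝ) → ℝ := fun x => MvPolynomial.eval x (orbitNormSq G)
  have hu : IsGevrey 0 fun x => u x + -J :=
    (IsGevrey.eval_mvPolynomial _).add (IsGevrey.const _)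
  have hcut : IsGevrey δ fun x => f x * (1 + (-1) * θ (u x + -J)) :=
    hf.mul hδ.le ((IsGevrey.const 1).add ((IsGevrey.const (-1)).mul hδ.le
      (hθ.comp hδ.le hu)))
  let L : EuclideanSpace ℝ (Fin n) →L[ℝ] (Fin n → ℝ) :=
    (EuclideanSpace.equiv (Fin n) ℝ : EuclideanSpace ℝ (Fin n) →L[ℝ] (Fin n → ℝ))
  let h : EuclideanSpace ℝ (Fin n) → ℂ := fun y =>
    Complex.ofRealCLM (f (L y) * (1 + (-1) * θ (u (L y) + -J)))
  have hh : IsGevrey δ h :=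
    (hcut.comp hδ.le (IsGevrey.clm le_rfl L)).clm_comp Complex.ofRealCLM
  have hs : HasCompactSupport h := by
    refine HasCompactSupport.intro (isCompact_closedBall 0 (J + 1)) fun y hy => ?_
    have hy' : J + 1 < ‖y‖ := by simpa using hy
    have h1 : ‖y‖ ^ 2 ≤ u (L y) := norm_toLp_sq_le_eval_orbitNormSq G (L y)
    have h2 : θ (u (L y) + -J) = 1 := hθ1 _ (by nlinarith)
    simp [h, h2]
  obtain ⟨C, hC, ρ, hρ, hb⟩ := hh.exists_bound_of_hasCompactSupport hs
  obtain ⟨F, hF, ⟨C', ρ', hC', hρ', hFb⟩, hFv⟩ :=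
    exists_gevrey_factor_orbitPolynomial G hh.1 hs hδ hρ hb (B₀ := J + 1) (by linarith)
  have hFg : IsGevrey (δ * Fintype.card G) F := by
    refine ⟨hF, fun r => ⟨C' * (1 + |r|), by positivity, ρ', hρ', fun k x hx => ?_⟩⟩
    refine (hFb k |r| x (abs_nonneg r) (hx.trans (le_abs_self r))).trans (le_of_eq ?_)
    ring
  refine ⟨fun b => Complex.reCLM (F b), hFg.clm_comp _, fun x hx => ?_⟩
  have hv := hFv (WithLp.toLp 2 x) fun g => by
    have h1 := norm_sq_le_eval_orbitNormSq G g x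
    exact (sq_le_sq₀ (norm_nonneg _) (by linarith)).1 (h1.trans (by nlinarith))
  have hg : ∀ g : G, h (WithLp.toLp 2 ((g : GL (Fin n) ℝ).val *ᵥ x)) = (f x : ℂ) := fun g => by
    have h1 : u ((g : GL (Fin n) ℝ).val *ᵥ x) = u x := eval_orbitNormSq_invariant G g.2 x
    have h2 : L (WithLp.toLp 2 ((g : GL (Fin n) ℝ).val *ᵥ x)) =
      (g : GL (Fin n) ℝ).val *ᵥ x := rfl
    have h3 : θ (u x + -J) = 0 := hθ0 _ (by linarith)
    simp only [h, h2, h1, h3, hfinv g g.2 x]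
    simp
  have hm : (Fintype.card G : ℂ) ≠ 0 := by exact_mod_cast Fintype.card_ne_zero
  simp only [hg, Finset.sum_const, Finset.card_univ, nsmul_eq_mul] at hv
  rw [inv_mul_cancel_left₀ hm] at hv
  change (F _).re = _
  rw [hv, Complex.ofReal_re]

/-- Gevrey functions that agree with a prescribed function on the sublevel sets of a polynomial
along a map can be glued. -/
theorem exists_isGevrey_glue {X ι : Type} [Fintype ι] {s : ℝ} (hs : 0 < s)
    (U : MvPolynomial ι ℝ) (τ : X → ι → ℝ) (hU : ∀ x, 0 ≤ MvPolynomial.eval (τ x) U)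
    (f : X → ℝ) (H : ℕ → (ι → ℝ) → ℝ) (hH : ∀ j, IsGevrey s (H j))
    (hHf : ∀ (j : ℕ) (x : X), MvPolynomial.eval (τ x) U ≤ j → H j (τ x) = f x) :
    ∃ F : (ι → ℝ) → ℝ, IsGevrey s F ∧ ∀ x, f x = F (τ x) := by
  obtain ⟨θ, hθ, hθ0, hθ1⟩ := exists_isGevrey_step hs
  set u : (ι → ℝ) → ℝ := fun t => MvPolynomial.eval t U
  have hu : IsGevrey 0 u := IsGevrey.eval_mvPolynomial U
  set S : ℕ → (ι → ℝ) → ℝ := fun j t => θ (u t + (1 - j))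
  have hS : ∀ j, IsGevrey s (S j) := fun j =>
    hθ.comp hs.le (hu.add (IsGevrey.const (1 - (j : ℝ))))
  have hS0 : ∀ (j : ℕ) t, u t + 1 ≤ j → S j t = 0 := fun j t h => hθ0 _ (by linarith)
  have hS1 : ∀ (j : ℕ) t, (j : ℝ) ≤ u t → S j t = 1 := fun j t h => hθ1 _ (by linarith)
  set T : ℕ → (ι → ℝ) → ℝ := fun j t => (S j t + (-1) * S (j + 1) t) * H (j + 1) t
  have hT : ∀ j, IsGevrey s (T j) := fun j =>
    ((hS j).add ((IsGevrey.const (-1)).mul hs.le (hS (j + 1)))).mul hs.le (hH (j + 1))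
  have hT0 : ∀ (N : ℕ) t, u t + 1 ≤ N → ∑' j, T j t = ∑ j ∈ Finset.range N, T j t :=
    fun N t h => tsum_eq_sum fun j hj => by
      have hj' : (N : ℝ) ≤ j := by exact_mod_cast not_lt.1 (mt Finset.mem_range.2 hj)
      simp only [T]
      rw [hS0 j t (by linarith), hS0 (j + 1) t (by push_cast; linarith)]
      ring
  refine ⟨fun t => ∑' j, T j t, IsGevrey.of_locally_eq fun r => ?_, fun x => ?_⟩
  · obtain ⟨C, _, ρ, _, hb⟩ := hu.2 r
    obtain ⟨N, hN⟩ := exists_nat_ge (C + 1)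
    refine ⟨_, IsGevrey.sum (Finset.range N) fun j _ => hT j, fun t ht => hT0 N t ?_⟩
    have h1 : ‖u t‖ ≤ C := by simpa using hb 0 t ht.le
    linarith [le_abs_self (u t), Real.norm_eq_abs (u t)]
  · obtain ⟨N, hN⟩ := exists_nat_ge (u (τ x) + 1)
    have h1 : ∀ j, T j (τ x) = (S j (τ x) - S (j + 1) (τ x)) * f x := fun j => by
      by_cases hj : u (τ x) ≤ (j + 1 : ℕ)
      · simp only [T]
        rw [hHf (j + 1) x hj]
        ring
      · rw [not_le] at hj
        have hj' := hj
        push_cast at hj'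
        simp only [T]
        rw [hS1 (j + 1) _ hj.le, hS1 j _ (by linarith)]
        ring
    change f x = ∑' j, T j (τ x)
    rw [hT0 N _ hN, Finset.sum_congr rfl fun j _ => h1 j, ← Finset.sum_mul,
      Finset.sum_range_sub', hS1 0 _ (by simpa using hU x), hS0 N _ hN]
    ring

/-- Let `G` be a finite subgroup of `GL(n,ℝ)` of order `m` and let
`σ₁, …, σ_p` be homogeneous generators of the algebra of `G`-invariant polynomials on `ℝⁿ`.
For `δ > 0`, every `G`-invariant Gevrey function `f ∈ G^{1+δ}(ℝⁿ)` has the form `f = F ∘ σ`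
with `F ∈ G^{1+δm}(ℝ^p)`.  (The Gevrey class `G^{1+δ}` is the Denjoy–Carleman class with
weight sequence `M_k = (k!)^δ`.) -/
theorem invariant_Gevrey_functions
    (n p m : ℕ) (hm : 0 < m)
    (G : Subgroup (GL (Fin n) ℝ)) (hG : Nat.card G = m)
    (σ : Fin p → MvPolynomial (Fin n) ℝ)
    (hhom : ∀ i, ∃ d : ℕ, (σ i).IsHomogeneous d)
    (hgen : (Algebra.adjoin ℝ (Set.range σ) : Set (MvPolynomial (Fin n) ℝ)) =
      {P : MvPolynomial (Fin n) ℝ | ∀ g ∈ G, ∀ x : Fin n → ℝ,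
        MvPolynomial.eval (g.val.mulVec x) P = MvPolynomial.eval x P})
    (δ : ℝ) (hδ : 0 < δ)
    (f : (Fin n → ℝ) → ℝ)
    (hf : CMClassOn (fun k => (k ! : ℝ) ^ δ) Set.univ f)
    (hfinv : ∀ g ∈ G, ∀ x : Fin n → ℝ, f (g.val.mulVec x) = f x) :
    ∃ F : (Fin p → ℝ) → ℝ,
      CMClassOn (fun k => (k ! : ℝ) ^ (δ * (m : ℝ))) Set.univ F ∧
      ∀ x : Fin n → ℝ, f x = F (fun i => MvPolynomial.eval x (σ i)) := by
  have hfin : Finite G := Nat.finite_of_card_ne_zero (by omega)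
  have : Fintype G := Fintype.ofFinite G
  have hcard : Fintype.card G = m := by rw [← Nat.card_eq_fintype_card, hG]
  have hs : 0 < δ * (m : ℝ) := by positivity
  have hpoly : ∀ P : MvPolynomial (Fin n) ℝ, (∀ g ∈ G, ∀ x : Fin n → ℝ,
      MvPolynomial.eval (g.val *ᵥ x) P = MvPolynomial.eval x P) →
      ∃ B : MvPolynomial (Fin p) ℝ, ∀ x : Fin n → ℝ,
        MvPolynomial.eval (fun i => MvPolynomial.eval x (σ i)) B = MvPolynomial.eval x P := by
    intro P hP
    have h1 : P ∈ Algebra.adjoin ℝ (Set.range σ) := by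
      rw [← SetLike.mem_coe, hgen]
      exact hP
    rw [Algebra.adjoin_range_eq_range_aeval] at h1
    obtain ⟨B, rfl⟩ := h1
    refine ⟨B, fun x => ?_⟩
    clear hP
    change _ = MvPolynomial.eval x (MvPolynomial.aeval σ B)
    induction B using MvPolynomial.induction_on with
    | C a => simp
    | add p q hp hq => simp_all
    | mul_X p i hp => simp_all
  obtain ⟨U, hU⟩ := hpoly (orbitNormSq G) fun g hg x => eval_orbitNormSq_invariant G hg x
  choose B hB using fun α : (orbitPolynomial G).support =>
    hpoly (MvPolynomial.coeff α.1 (orbitPolynomial G)) fun g hg x =>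
      eval_coeff_orbitPolynomial_invariant G α.1 hg x
  choose H hH hHf using fun j : ℕ =>
    exists_isGevrey_coeff_orbitPolynomial G hδ (IsGevrey.iff_CMClassOn.2 hf) hfinv
      (Nat.cast_nonneg (α := ℝ) j)
  rw [hcard] at hH
  have hnonneg : ∀ x : Fin n → ℝ,
      0 ≤ MvPolynomial.eval (fun i => MvPolynomial.eval x (σ i)) U := fun x => by
    rw [hU]
    exact (sq_nonneg _).trans (norm_toLp_sq_le_eval_orbitNormSq G x)
  obtain ⟨F, hF, hFf⟩ := exists_isGevrey_glue hs U
    (fun x i => MvPolynomial.eval x (σ i)) hnonneg f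
    (fun j t => H j fun α => MvPolynomial.eval t (B α))
    (fun j => (hH j).comp hs.le (IsGevrey.pi fun α => IsGevrey.eval_mvPolynomial (B α)))
    (fun j x hx => by
      rw [hU] at hx
      simp only [hB]
      exact hHf j x hx)
  exact ⟨F, IsGevrey.iff_CMClassOn.1 hF, hFf⟩
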